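/- arXiv:2010.15000 — 3 statements merged into one kernel-verified Lean document; each statement's English description precedes it below -/
import Mathlib

section
/- Let k > 0 and let C be a C²-smooth Jordan curve of unit length with curvature κ ≥ k everywhere. For any two points z1, z2 ∈ C, if L(z2) denotes the tangent line to C at z2, then dist(z1, L(z2)) ≥ (k/(2π)) · length(C|[z1,z2])², where C|[z1,z2] is the shortest arc of C joining z1 and z2. -/
open Set Complex ComplexConjugate

/-- A continuous strictly increasing function on a compact interval has a continuous right
inverse. -/
theorem StrictMonoOn.exists_continuousOn_rightInverse {f : ℝ → ℝ} {a b : ℝ} (hab : a ≤ b)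
    (hf : StrictMonoOn f (Icc a b)) (hc : ContinuousOn f (Icc a b)) :
    ∃ g : ℝ → ℝ, ContinuousOn g (Icc (f a) (f b)) ∧
      ∀ y ∈ Icc (f a) (f b), g y ∈ Icc a b ∧ f (g y) = y := by
  have him : f '' Icc a b = Icc (f a) (f b) := by
    apply Subset.antisymm
    · rintro _ ⟨x, hx, rfl⟩
      exact ⟨hf.monotoneOn (left_mem_Icc.2 hab) hx hx.1,
        hf.monotoneOn hx (right_mem_Icc.2 hab) hx.2⟩
    · exact intermediate_value_Icc hab hc
  have : OrdConnected (f '' Icc a b) := by rw [him]; exact ordConnected_Icc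
  set e := hf.orderIso f (Icc a b)
  have hmem : ∀ y ∈ Icc (f a) (f b), y ∈ f '' Icc a b := fun y hy => him ▸ hy
  classical
  refine ⟨fun y => if h : y ∈ f '' Icc a b then (e.symm ⟨y, h⟩ : ℝ) else 0, ?_, ?_⟩
  · rw [← him, continuousOn_iff_continuous_domRestrict]
    have : (f '' Icc a b).domRestrict
        (fun y => if h : y ∈ f '' Icc a b then (e.symm ⟨y, h⟩ : ℝ) else 0) =
        fun y => (e.symm y : ℝ) := by
      ext ⟨y, hy⟩
      simp only [domRestrict_apply, dif_pos hy]
    rw [this]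
    exact continuous_subtype_val.comp e.symm.continuous
  · intro y hy
    simp only [dif_pos (hmem y hy)]
    refine ⟨(e.symm ⟨y, hmem y hy⟩).2, ?_⟩
    have := congrArg Subtype.val (e.apply_symm_apply ⟨y, hmem y hy⟩)
    exact this

/-- A periodic differentiable function with a zero has a zero at which it is not increasing. -/
theorem Function.Periodic.exists_eq_zero_deriv_nonpos {q q' : ℝ → ℝ} {P : ℝ} (hP : 0 < P)
    (hq : Function.Periodic q P) (hd : ∀ x, HasDerivAt q (q' x) x) {x₀ : ℝ} (h0 : q x₀ = 0) :
    ∃ x, q x = 0 ∧ q' x ≤ 0 := by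
  by_contra! H
  have hnn : ∀ x, x₀ ≤ x → 0 ≤ q x := by
    intro x hx
    have := image_le_of_deriv_right_lt_deriv_boundary (f := fun x => -q x) (f' := fun x => -q' x)
      (a := x₀) (b := x) (B := fun _ => (0 : ℝ)) (B' := fun _ => (0 : ℝ))
      (fun y _ => (hd y).neg.continuousAt.continuousWithinAt)
      (fun y _ => (hd y).neg.hasDerivWithinAt) (by simp [h0])
      (fun y => hasDerivAt_const _ _)
      (fun y _ hy => by have := H y (by simpa using hy); simpa using this)
      (right_mem_Icc.2 hx)
    simpa using this
  have hmin : IsLocalMin q (x₀ + P) := by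
    filter_upwards [Ioi_mem_nhds (show x₀ < x₀ + P by linarith)] with y hy
    rw [hq x₀, h0]
    exact hnn y (le_of_lt hy)
  have := hmin.hasDerivAt_eq_zero (hd _)
  have h2 := H (x₀ + P) (by rw [hq, h0])
  linarith

/-- A curve parametrized by its tangent angle over one full turn, whose endpoints lie on a common
tangent line with the final point not behind the initial one, intersects itself. -/
theorem exists_selfIntersection_of_full_turn {G : ℝ → ℂ} {ρ : ℝ → ℝ} (hρ : ∀ x, 0 < ρ x)
    (hG : ∀ x : ℝ, HasDerivAt G (ρ x * exp (x * I)) x)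
    (him : (G (2 * Real.pi)).im = (G 0).im) (hre : (G 0).re ≤ (G (2 * Real.pi)).re) :
    ∃ α β, 0 ≤ α ∧ α < β ∧ β ≤ 2 * Real.pi ∧ G α = G β := by
  have hpi := Real.pi_pos
  have hX : ∀ x : ℝ, HasDerivAt (fun x => (G x).re) (ρ x * Real.cos x) x := fun x => by
    have := (Complex.reCLM.hasFDerivAt.comp_hasDerivAt x (hG x))
    simpa [Function.comp_def, exp_ofReal_mul_I_re] using this
  have hY : ∀ x : ℝ, HasDerivAt (fun x => (G x).im) (ρ x * Real.sin x) x := fun x => by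
    have := (Complex.imCLM.hasFDerivAt.comp_hasDerivAt x (hG x))
    simpa [Function.comp_def, exp_ofReal_mul_I_im] using this
  have hY2 : ∀ x : ℝ, HasDerivAt (fun x => (G (2 * Real.pi - x)).im)
      (ρ (2 * Real.pi - x) * Real.sin x) x := fun x => by
    have := (hY (2 * Real.pi - x)).comp x ((hasDerivAt_id x).const_sub (2 * Real.pi))
    simpa [Function.comp_def, Real.sin_two_pi_sub] using this
  have hXc : Continuous fun x => (G x).re :=
    continuous_iff_continuousAt.2 fun x => (hX x).continuousAt
  have hYc : Continuous fun x => (G x).im :=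
    continuous_iff_continuousAt.2 fun x => (hY x).continuousAt
  have hY2c : Continuous fun x => (G (2 * Real.pi - x)).im :=
    continuous_iff_continuousAt.2 fun x => (hY2 x).continuousAt
  have m1 : StrictMonoOn (fun x => (G x).im) (Icc 0 Real.pi) := by
    refine strictMonoOn_of_deriv_pos (convex_Icc _ _) hYc.continuousOn fun x hx => ?_
    rw [interior_Icc] at hx
    rw [(hY x).deriv]
    exact mul_pos (hρ _) (Real.sin_pos_of_pos_of_lt_pi hx.1 hx.2)
  have m2 : StrictMonoOn (fun x => (G (2 * Real.pi - x)).im) (Icc 0 Real.pi) := by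
    refine strictMonoOn_of_deriv_pos (convex_Icc _ _) hY2c.continuousOn fun x hx => ?_
    rw [interior_Icc] at hx
    rw [(hY2 x).deriv]
    exact mul_pos (hρ _) (Real.sin_pos_of_pos_of_lt_pi hx.1 hx.2)
  have m3 : AntitoneOn (fun x => (G x).re) (Icc (Real.pi / 2) (Real.pi + Real.pi / 2)) := by
    refine antitoneOn_of_deriv_nonpos (convex_Icc _ _) hXc.continuousOn
      (fun x _ => (hX x).differentiableAt.differentiableWithinAt) fun x hx => ?_
    rw [interior_Icc] at hx
    rw [(hX x).deriv]
    exact mul_nonpos_of_nonneg_of_nonpos (hρ _).le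
      (Real.cos_nonpos_of_pi_div_two_le_of_le hx.1.le hx.2.le)
  obtain ⟨A, hAc, hA⟩ := m1.exists_continuousOn_rightInverse hpi.le hYc.continuousOn
  obtain ⟨B, hBc, hB⟩ := m2.exists_continuousOn_rightInverse hpi.le hY2c.continuousOn
  simp only [sub_zero] at hB hBc
  rw [him, show 2 * Real.pi - Real.pi = Real.pi by ring] at hB hBc
  set M := (G Real.pi).im
  set c := (G 0).im with hc
  have zm : (0 : ℝ) ∈ Icc 0 Real.pi := ⟨le_rfl, hpi.le⟩
  have pm : Real.pi ∈ Icc 0 Real.pi := ⟨hpi.le, le_rfl⟩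
  have hm : Real.pi / 2 ∈ Icc 0 Real.pi := ⟨by linarith, by linarith⟩
  have a1 := m1 zm hm (by linarith)
  have a2 := m1 hm pm (by linarith)
  have b1 := m2 zm hm (by linarith)
  have b2 := m2 hm pm (by linarith)
  simp only [sub_zero] at a1 a2 b1 b2
  rw [show 2 * Real.pi - Real.pi = Real.pi by ring] at b2
  set y := max (G (Real.pi / 2)).im (G (2 * Real.pi - Real.pi / 2)).im
  have hyM : y < M := max_lt a2 b2
  have hcy : c ≤ y := a1.le.trans (le_max_left _ _)
  have cm : c ∈ Icc c M := ⟨le_rfl, by linarith⟩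
  have ym : y ∈ Icc c M := ⟨hcy, hyM.le⟩
  have hA0 : A c = 0 := m1.injOn (hA c cm).1 zm (hA c cm).2
  have hB0 : B c = 0 := m2.injOn (hB c cm).1 zm (by
    have := (hB c cm).2
    simp only [sub_zero]
    rw [this, him])
  have hAy : Real.pi / 2 ≤ A y := by
    rw [← m1.le_iff_le hm (hA y ym).1]
    simp only [(hA y ym).2]
    exact le_max_left _ _
  have hBy : Real.pi / 2 ≤ B y := by
    rw [← m2.le_iff_le hm (hB y ym).1]
    simp only [(hB y ym).2]
    exact le_max_right _ _
  have hsub : Icc c y ⊆ Icc c M := Icc_subset_Icc le_rfl hyM.le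
  have hDc : ContinuousOn (fun y => (G (A y)).re - (G (2 * Real.pi - B y)).re) (Icc c y) :=
    (hXc.comp_continuousOn (hAc.mono hsub)).sub
      (hXc.comp_continuousOn (continuousOn_const.sub (hBc.mono hsub)))
  have hDy : 0 ≤ (G (A y)).re - (G (2 * Real.pi - B y)).re := by
    have h1 := (hA y ym).1.2
    have h2 := (hB y ym).1.2
    have := m3 (a := A y) (b := 2 * Real.pi - B y) ⟨hAy, by linarith⟩
      ⟨by linarith, by linarith⟩ (by linarith)
    linarith
  obtain ⟨z, hz, hz0⟩ := intermediate_value_Icc hcy hDc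
    (show (0 : ℝ) ∈ Icc _ _ from ⟨by simp only [hA0, hB0, sub_zero]; linarith, hDy⟩)
  have zM := hsub hz
  obtain ⟨⟨hz1, hz2⟩, hz3⟩ := hA z zM
  obtain ⟨⟨hz4, hz5⟩, hz6⟩ := hB z zM
  refine ⟨A z, 2 * Real.pi - B z, hz1, ?_, by linarith, ?_⟩
  · have : A z ≠ Real.pi := by
      intro h
      rw [h] at hz3
      have := hz.2
      linarith
    have := lt_of_le_of_ne hz2 this
    linarith
  · apply Complex.ext
    · simp only at hz0
      linarith
    · exact hz3.trans hz6.symm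

/-- A closed curve parametrized by its tangent angle, closing up after `m ≥ 1` turns, has a full
turn starting and ending on a common tangent line, the end not being behind the start. -/
theorem exists_common_tangent {g : ℝ → ℂ} {ρ : ℝ → ℝ} {m : ℕ} (hm : 0 < m)
    (hg : ∀ x : ℝ, HasDerivAt g (ρ x * exp (x * I)) x)
    (hper : Function.Periodic g (2 * Real.pi * m)) :
    ∃ x : ℝ, ((g (x + 2 * Real.pi) - g x) * exp (-x * I)).im = 0 ∧
      0 ≤ ((g (x + 2 * Real.pi) - g x) * exp (-x * I)).re := by
  have hpi := Real.pi_pos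
  have hexp : ∀ x : ℝ, exp (-((x + 2 * Real.pi : ℝ) : ℂ) * I) = exp (-x * I) := fun x => by
    have := Complex.exp_periodic (-((x + 2 * Real.pi : ℝ) : ℂ) * I)
    rw [← this]
    congr 1
    push_cast
    ring
  set p : ℝ → ℝ := fun x => (g x * exp (-x * I)).im with hp
  have hpd : ∀ x : ℝ, HasDerivAt p (-(g x * exp (-x * I)).re) x := fun x => by
    have h1 : HasDerivAt (fun x : ℝ => exp (-x * I)) (exp (-x * I) * (-1 * I)) x := by
      have h := ((hasDerivAt_id x).ofReal_comp.neg.mul_const I).cexp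
      simpa using h
    have h2 := (Complex.imCLM.hasFDerivAt.comp_hasDerivAt x ((hg x).mul h1))
    refine h2.congr_deriv ?_
    have h3 : exp (x * I) * exp (-x * I) = 1 := by
      rw [← Complex.exp_add]; simp
    rw [mul_assoc (ρ x : ℂ), h3]
    simp [mul_comm, mul_left_comm]
  have hpp : Function.Periodic p (2 * Real.pi * m) := fun x => by
    simp only [hp, hper x]
    have : exp (-((x + 2 * Real.pi * m : ℝ) : ℂ) * I) = exp (-x * I) := by
      have := Complex.exp_periodic.nat_mul m (-((x + 2 * Real.pi * m : ℝ) : ℂ) * I)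
      rw [← this]
      congr 1
      push_cast
      ring
    rw [this]
  set q : ℝ → ℝ := fun x => p (x + 2 * Real.pi) - p x with hqdef
  have hqd : ∀ x, HasDerivAt q (-((g (x + 2 * Real.pi) - g x) * exp (-x * I)).re) x := fun x => by
    refine (((hpd (x + 2 * Real.pi)).comp_add_const x (2 * Real.pi)).sub (hpd x)).congr_deriv ?_
    rw [hexp, sub_mul, sub_re]
    ring
  have hq : ∀ x, q x = ((g (x + 2 * Real.pi) - g x) * exp (-x * I)).im := fun x => by
    simp only [hqdef, hp]
    rw [hexp, sub_mul, sub_im]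
  have hqp : Function.Periodic q (2 * Real.pi * m) := fun x => by
    simp only [hqdef]
    rw [hpp x, ← hpp (x + 2 * Real.pi)]
    congr 2
    ring
  have hsum : ∑ j ∈ Finset.range m, q (2 * Real.pi * j) = 0 := by
    have : ∀ j : ℕ, q (2 * Real.pi * j) =
        (fun j : ℕ => p (2 * Real.pi * j)) (j + 1) - (fun j : ℕ => p (2 * Real.pi * j)) j := by
      intro j
      simp only [hqdef]
      push_cast
      rw [mul_add, mul_one]
    rw [Finset.sum_congr rfl fun j _ => this j,
      Finset.sum_range_sub fun j : ℕ => p (2 * Real.pi * j)]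
    have := hpp 0
    rw [zero_add] at this
    simp [this]
  have hne : (Finset.range m).Nonempty := Finset.nonempty_range_iff.2 hm.ne'
  obtain ⟨i, -, hi⟩ := Finset.exists_le_of_sum_le (f := fun j : ℕ => q (2 * Real.pi * j))
    (g := fun _ => (0 : ℝ)) hne (by simp [hsum])
  obtain ⟨j, -, hj⟩ := Finset.exists_le_of_sum_le (g := fun j : ℕ => q (2 * Real.pi * j))
    (f := fun _ => (0 : ℝ)) hne (by simp [hsum])
  obtain ⟨x₀, hx₀⟩ := mem_range_of_exists_le_of_exists_ge
    (continuous_iff_continuousAt.2 fun x => (hqd x).continuousAt) ⟨_, hi⟩ ⟨_, hj⟩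
  obtain ⟨x, hx, hx'⟩ := hqp.exists_eq_zero_deriv_nonpos (by positivity) hqd hx₀
  exact ⟨x, by rw [← hq, hx], by linarith⟩

/-- Lower bound for the height of an arc whose tangent angle `ψ` grows at rate at least `k` and
stays in `[0, π]`. -/
theorem le_sub_of_hasDerivAt_sin {f ψ : ℝ → ℝ} {a b k : ℝ} (hk : 0 ≤ k) (hab : a ≤ b)
    (hf : ∀ x, HasDerivAt f (Real.sin (ψ x)) x)
    (hψ : ∀ x y, x ≤ y → k * (y - x) ≤ ψ y - ψ x) (ha : 0 ≤ ψ a) (hb : ψ b ≤ Real.pi) :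
    k / (2 * Real.pi) * (b - a) ^ 2 ≤ f b - f a := by
  have hpi := Real.pi_pos
  have key : ∀ x c, 0 ≤ c → c ≤ x → c ≤ Real.pi - x → 2 / Real.pi * c ≤ Real.sin x := by
    intro x c h0 h1 h2
    rcases le_total x (Real.pi / 2) with h | h
    · exact (mul_le_mul_of_nonneg_left h1 (by positivity)).trans
        (Real.mul_le_sin (h0.trans h1) h)
    · rw [← Real.sin_pi_sub]
      exact (mul_le_mul_of_nonneg_left h2 (by positivity)).trans
        (Real.mul_le_sin (h0.trans h2) (by linarith))
  have hfc : Continuous f := continuous_iff_continuousAt.2 fun x => (hf x).continuousAt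
  set c := (a + b) / 2 with hc
  have d1 : ∀ x, HasDerivAt (fun x => f x - k / Real.pi * (x - a) ^ 2)
      (Real.sin (ψ x) - 2 / Real.pi * (k * (x - a))) x := fun x => by
    have := (hf x).sub ((((hasDerivAt_id x).sub_const a).pow 2).const_mul (k / Real.pi))
    refine this.congr_deriv ?_
    simp
    ring
  have d2 : ∀ x, HasDerivAt (fun x => f x + k / Real.pi * (b - x) ^ 2)
      (Real.sin (ψ x) - 2 / Real.pi * (k * (b - x))) x := fun x => by
    have := (hf x).add ((((hasDerivAt_id x).const_sub b).pow 2).const_mul (k / Real.pi))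
    refine this.congr_deriv ?_
    simp
    ring
  have m1 : MonotoneOn (fun x => f x - k / Real.pi * (x - a) ^ 2) (Icc a c) := by
    refine monotoneOn_of_deriv_nonneg (convex_Icc _ _)
      (fun x _ => (d1 x).continuousAt.continuousWithinAt)
      (fun x _ => (d1 x).differentiableAt.differentiableWithinAt) fun x hx => ?_
    rw [interior_Icc] at hx
    rw [(d1 x).deriv, sub_nonneg]
    have h1 := hψ a x hx.1.le
    have h2 := hψ x b (by linarith [hx.2])
    have h3 : k * (x - a) ≤ k * (b - x) := mul_le_mul_of_nonneg_left (by linarith [hx.2]) hk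
    exact key _ _ (mul_nonneg hk (by linarith [hx.1])) (by linarith) (by linarith)
  have m2 : MonotoneOn (fun x => f x + k / Real.pi * (b - x) ^ 2) (Icc c b) := by
    refine monotoneOn_of_deriv_nonneg (convex_Icc _ _)
      (fun x _ => (d2 x).continuousAt.continuousWithinAt)
      (fun x _ => (d2 x).differentiableAt.differentiableWithinAt) fun x hx => ?_
    rw [interior_Icc] at hx
    rw [(d2 x).deriv, sub_nonneg]
    have h1 := hψ a x (by linarith [hx.1])
    have h2 := hψ x b hx.2.le
    have h3 : k * (b - x) ≤ k * (x - a) := mul_le_mul_of_nonneg_left (by linarith [hx.1]) hk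
    exact key _ _ (mul_nonneg hk (by linarith [hx.2])) (by linarith) (by linarith)
  have e1 := m1 (a := a) (b := c) ⟨le_rfl, by linarith⟩ ⟨by linarith, le_rfl⟩ (by linarith)
  have e2 := m2 (a := c) (b := b) ⟨le_rfl, by linarith⟩ ⟨by linarith, le_rfl⟩ (by linarith)
  simp only at e1 e2
  have e3 : k / (2 * Real.pi) * (b - a) ^ 2 =
      k / Real.pi * (c - a) ^ 2 + k / Real.pi * (b - c) ^ 2 := by
    rw [hc]; field_simp; ring
  have e4 : k / Real.pi * (a - a) ^ 2 = 0 := by simp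
  have e5 : k / Real.pi * (b - b) ^ 2 = 0 := by simp
  linarith

/-- If `γ` is `1`-periodic and injective on `[0, 1)`, then it is injective on every interval of
length less than `1`. -/
theorem Function.Periodic.ne_of_lt_of_lt_add_one {E : Type*} {γ : ℝ → E}
    (hper : Function.Periodic γ 1) (hinj : InjOn γ (Ico 0 1)) {x y : ℝ} (h1 : x < y)
    (h2 : y < x + 1) : γ x ≠ γ y := by
  intro h
  have hf : ∀ z, γ (Int.fract z) = γ z := fun z => by
    have := hper.sub_int_mul_eq ⌊z⌋ (x := z)
    rwa [mul_one] at this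
  have := hinj ⟨Int.fract_nonneg x, Int.fract_lt_one x⟩ ⟨Int.fract_nonneg y, Int.fract_lt_one y⟩
    (by rw [hf, hf, h])
  obtain ⟨n, hn⟩ := Int.fract_eq_fract.1 this
  have h3 : (-1 : ℝ) < n := by linarith
  have h4 : (n : ℝ) < 0 := by linarith
  have h5 : (-1 : ℤ) < n := by exact_mod_cast h3
  have h6 : n < 0 := by exact_mod_cast h4
  omega

/-- The tangent angle of a simple closed curve with curvature bounded below by `k > 0` increases
by exactly `2π` along the curve. -/
theorem tangentAngle_add_one {k : ℝ} (hk : 0 < k) {γ : ℝ → ℂ} {θ κ : ℝ → ℝ}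
    (hper : Function.Periodic γ 1) (hinj : InjOn γ (Ico 0 1))
    (hγ : ∀ t, HasDerivAt γ (exp (θ t * I)) t) (hθ : ∀ t, HasDerivAt θ (κ t) t)
    (hκ : ∀ t, k ≤ κ t) (hκp : Function.Periodic κ 1) (t : ℝ) :
    θ (t + 1) = θ t + 2 * Real.pi := by
  have hpi := Real.pi_pos
  have hθc : Continuous θ := continuous_iff_continuousAt.2 fun x => (hθ x).continuousAt
  have hmono : StrictMono θ := strictMono_of_deriv_pos fun x => by
    rw [(hθ x).deriv]; linarith [hκ x]
  have hgrow : Monotone fun x => θ x - k * x := by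
    have hd : ∀ x, HasDerivAt (fun x => θ x - k * x) (κ x - k) x := fun x =>
      ((hθ x).sub ((hasDerivAt_id x).const_mul k)).congr_deriv (by simp)
    exact monotone_of_deriv_nonneg (fun x => (hd x).differentiableAt) fun x => by
      rw [(hd x).deriv]; linarith [hκ x]
  have hconst : ∀ x, θ (x + 1) - θ x = θ 1 - θ 0 := by
    have hd : ∀ x, HasDerivAt (fun x => θ (x + 1) - θ x) 0 x := fun x =>
      (((hθ (x + 1)).comp_add_const x 1).sub (hθ x)).congr_deriv (by rw [hκp x, sub_self])
    intro x
    have := is_const_of_deriv_eq_zero (fun x => (hd x).differentiableAt) (fun x => (hd x).deriv)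
      x 0
    simpa using this
  have hexp : exp (θ 1 * I) = exp (θ 0 * I) := by
    have h1 := (hγ (0 + 1)).comp_add_const 0 1
    rw [show (fun x => γ (x + 1)) = γ from funext hper, zero_add] at h1
    exact h1.unique (hγ 0)
  obtain ⟨n, hn⟩ := Complex.exp_eq_exp_iff_exists_int.1 hexp
  have hn' : θ 1 = θ 0 + n * (2 * Real.pi) := by
    have := congrArg Complex.im hn
    simpa using this
  have hlt : θ 0 < θ 1 := hmono one_pos
  have hn0 : 0 < n := by
    have : (0 : ℝ) < n := by
      by_contra! h
      nlinarith
    exact_mod_cast this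
  obtain ⟨m, rfl⟩ := Int.eq_ofNat_of_zero_le hn0.le
  have hm0 : 0 < m := by exact_mod_cast hn0
  simp only [Int.cast_natCast] at hn'
  have hturn : ∀ x, θ (x + 1) = θ x + 2 * Real.pi * m := fun x => by linarith [hconst x]
  suffices h : m = 1 by rw [hturn, h]; simp
  by_contra hm1
  have hm2 : (2 : ℝ) ≤ m := by exact_mod_cast (show 2 ≤ m by omega)
  have hsurj : Function.Surjective θ := by
    intro y
    refine mem_range_of_exists_le_of_exists_ge hθc ⟨min 0 ((y - θ 0) / k), ?_⟩
      ⟨max 0 ((y - θ 0) / k), ?_⟩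
    · have h1 := hgrow (min_le_left 0 ((y - θ 0) / k))
      have h2 : k * min 0 ((y - θ 0) / k) ≤ k * ((y - θ 0) / k) :=
        mul_le_mul_of_nonneg_left (min_le_right _ _) hk.le
      rw [mul_div_cancel₀ _ hk.ne'] at h2
      simp only [mul_zero] at h1
      linarith
    · have h1 := hgrow (le_max_left 0 ((y - θ 0) / k))
      have h2 : k * ((y - θ 0) / k) ≤ k * max 0 ((y - θ 0) / k) :=
        mul_le_mul_of_nonneg_left (le_max_right _ _) hk.le
      rw [mul_div_cancel₀ _ hk.ne'] at h2
      simp only [mul_zero] at h1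
      linarith
  set e := hmono.orderIsoOfSurjective θ hsurj
  have he1 : ∀ y, θ (e.symm y) = y := fun y => e.apply_symm_apply y
  have he2 : ∀ y, e.symm (y + 2 * Real.pi * m) = e.symm y + 1 := fun y =>
    hmono.injective (by rw [he1, hturn, he1])
  have hed : ∀ y, HasDerivAt e.symm (κ (e.symm y))⁻¹ y := fun y =>
    HasDerivAt.of_local_left_inverse e.symm.continuous.continuousAt (hθ _)
      (by linarith [hκ (e.symm y)]) (Filter.Eventually.of_forall he1)
  set g : ℝ → ℂ := fun y => γ (e.symm y) with hgdef
  have hg : ∀ y : ℝ, HasDerivAt g (((κ (e.symm y))⁻¹ : ℝ) * exp (y * I)) y := fun y => by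
    have := (hγ (e.symm y)).scomp y (hed y)
    rw [he1] at this
    simpa [Function.comp_def, hgdef] using this
  have hgp : Function.Periodic g (2 * Real.pi * m) := fun y => by
    simp only [hgdef, he2, hper _]
  obtain ⟨x, hx1, hx2⟩ := exists_common_tangent hm0 hg hgp
  have hG : ∀ y : ℝ, HasDerivAt (fun y => g (x + y) * exp (-x * I))
      (((κ (e.symm (x + y)))⁻¹ : ℝ) * exp (y * I)) y := fun y => by
    refine (((hg (x + y)).comp_const_add x y).mul_const _).congr_deriv ?_
    rw [mul_assoc, ← Complex.exp_add]
    congr 2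
    push_cast
    ring
  obtain ⟨α, β, h1, h2, h3, h4⟩ := exists_selfIntersection_of_full_turn
    (G := fun y => g (x + y) * exp (-x * I)) (ρ := fun y => (κ (e.symm (x + y)))⁻¹)
    (fun y => inv_pos.2 (by linarith [hκ (e.symm (x + y))])) hG
    (by rw [sub_mul, sub_im] at hx1; simp only [add_zero]; linarith)
    (by rw [sub_mul, sub_re] at hx2; simp only [add_zero]; linarith)
  have h5 : g (x + α) = g (x + β) := mul_right_cancel₀ (Complex.exp_ne_zero _) h4
  refine hper.ne_of_lt_of_lt_add_one hinj (e.symm.strictMono (show x + α < x + β by linarith))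
    ?_ h5
  rw [← he2]
  apply e.symm.strictMono
  nlinarith

/-- The height of a simple closed curve of curvature at least `k` over one of its tangent lines,
in terms of a positively oriented tangent angle. -/
theorem le_im_sub_mul_exp {k : ℝ} (hk : 0 < k) {γ : ℝ → ℂ} {θ κ : ℝ → ℝ}
    (hper : Function.Periodic γ 1) (hinj : InjOn γ (Ico 0 1))
    (hγ : ∀ t, HasDerivAt γ (exp (θ t * I)) t) (hθ : ∀ t, HasDerivAt θ (κ t) t)
    (hκ : ∀ t, k ≤ κ t) (hκp : Function.Periodic κ 1) {a t : ℝ} (ha : a ≤ t) (hb : t ≤ a + 1) :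
    k / (2 * Real.pi) * (min (t - a) (a + 1 - t)) ^ 2 ≤
      ((γ t - γ a) * exp (-θ a * I)).im := by
  have hpi := Real.pi_pos
  have hturn := tangentAngle_add_one hk hper hinj hγ hθ hκ hκp a
  have hgrow : ∀ x y, x ≤ y → k * (y - x) ≤ θ y - θ x := by
    have hd : ∀ x, HasDerivAt (fun x => θ x - k * x) (κ x - k) x := fun x =>
      ((hθ x).sub ((hasDerivAt_id x).const_mul k)).congr_deriv (by simp)
    have : Monotone fun x => θ x - k * x :=
      monotone_of_deriv_nonneg (fun x => (hd x).differentiableAt) fun x => by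
        rw [(hd x).deriv]; linarith [hκ x]
    intro x y hxy
    have := this hxy
    simp only at this
    linarith
  set h : ℝ → ℝ := fun t => ((γ t - γ a) * exp (-θ a * I)).im with hh
  have hd : ∀ x, HasDerivAt h (Real.sin (θ x - θ a)) x := fun x => by
    have := Complex.imCLM.hasFDerivAt.comp_hasDerivAt x
      (((hγ x).sub_const (γ a)).mul_const (exp (-θ a * I)))
    refine this.congr_deriv ?_
    rw [← Complex.exp_add, ← add_mul, ← sub_eq_add_neg, ← ofReal_sub]
    exact exp_ofReal_mul_I_im _
  have ha0 : h a = 0 := by simp [hh]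
  have ha1 : h (a + 1) = 0 := by simp [hh, hper a]
  have hnn : 0 ≤ min (t - a) (a + 1 - t) := le_min (by linarith) (by linarith)
  change _ ≤ h t
  rcases le_total (θ t - θ a) Real.pi with hc | hc
  · have := le_sub_of_hasDerivAt_sin hk.le ha hd
      (fun x y hxy => by have := hgrow x y hxy; linarith) (by simp) hc
    refine le_trans ?_ (this.trans (by linarith))
    gcongr
    exact min_le_left _ _
  · have := le_sub_of_hasDerivAt_sin (f := fun x => -h x) (ψ := fun x => θ x - θ a - Real.pi)
      hk.le hb (fun x => (hd x).neg.congr_deriv (by rw [Real.sin_sub_pi]))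
      (fun x y hxy => by have := hgrow x y hxy; linarith) (by linarith) (by linarith)
    refine le_trans ?_ (this.trans (by linarith))
    gcongr
    exact min_le_right _ _

/-- The derivative of a curve in the unit circle is orthogonal to the curve. -/
theorem HasDerivAt.re_mul_conj_eq_zero {f : ℝ → ℂ} {f' : ℂ} {t : ℝ} (hf : HasDerivAt f f' t)
    (hnorm : ∀ t, ‖f t‖ = 1) : (f' * conj (f t)).re = 0 := by
  have h1 := hf.norm_sq
  simp only [hnorm] at h1
  have h2 := h1.unique (hasDerivAt_const t ((1 : ℝ) ^ 2))
  rw [Complex.inner] at h2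
  linarith

/-- The height of a simple closed unit-speed curve whose signed curvature is at least `k` over one
of its tangent lines. -/
theorem le_im_sub_mul_conj_deriv {k : ℝ} (hk : 0 < k) {γ : ℝ → ℂ}
    (hper : Function.Periodic γ 1) (hsmooth : ContDiff ℝ 2 γ) (hinj : InjOn γ (Ico 0 1))
    (hspeed : ∀ t, ‖deriv γ t‖ = 1)
    (hcurv : ∀ t, k ≤ (deriv (deriv γ) t * conj (deriv γ t)).im)
    {a t : ℝ} (ha : a ≤ t) (hb : t ≤ a + 1) :
    k / (2 * Real.pi) * (min (t - a) (a + 1 - t)) ^ 2 ≤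
      ((γ t - γ a) * conj (deriv γ a)).im := by
  have hγ1 : ∀ t, HasDerivAt γ (deriv γ t) t := fun t =>
    (hsmooth.differentiable (by norm_num) t).hasDerivAt
  have hs1 : ContDiff ℝ 1 (deriv γ) :=
    (show ContDiff ℝ (1 + 1) γ by rwa [one_add_one_eq_two]).deriv'
  have hγ2 : ∀ t, HasDerivAt (deriv γ) (deriv (deriv γ) t) t := fun t =>
    (hs1.differentiable (by norm_num) t).hasDerivAt
  have hc2 : Continuous (deriv (deriv γ)) := hs1.continuous_deriv (by norm_num)
  have hp1 : Function.Periodic (deriv γ) 1 := fun t => by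
    rw [← deriv_comp_add_const, show (fun x => γ (x + 1)) = γ from funext hper]
  have hp2 : Function.Periodic (deriv (deriv γ)) 1 := fun t => by
    rw [← deriv_comp_add_const, show (fun x => deriv γ (x + 1)) = deriv γ from funext hp1]
  set κ : ℝ → ℝ := fun t => (deriv (deriv γ) t * conj (deriv γ t)).im with hκ
  have hκc : Continuous κ :=
    Complex.continuous_im.comp (hc2.mul (Complex.continuous_conj.comp hs1.continuous))
  have hκp : Function.Periodic κ 1 := fun t => by simp only [hκ, hp1 t, hp2 t]
  have hunit : ∀ t, deriv γ t * conj (deriv γ t) = 1 := fun t => by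
    rw [Complex.mul_conj, Complex.normSq_eq_norm_sq, hspeed]; simp
  have hfrenet : ∀ t, deriv (deriv γ) t = κ t * I * deriv γ t := fun t => by
    have h5 : deriv (deriv γ) t * conj (deriv γ t) = κ t * I := by
      rw [← re_add_im (deriv (deriv γ) t * conj (deriv γ t)),
        (hγ2 t).re_mul_conj_eq_zero hspeed, ofReal_zero, zero_add]
    rw [← h5, mul_assoc, mul_comm (conj _), hunit, mul_one]
  set θ : ℝ → ℝ := fun t => (deriv γ 0).arg + ∫ u in (0 : ℝ)..t, κ u with hθdef
  have hθ : ∀ t, HasDerivAt θ (κ t) t := fun t =>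
    (intervalIntegral.integral_hasDerivAt_right (hκc.intervalIntegrable _ _)
      (hκc.stronglyMeasurableAtFilter _ _) hκc.continuousAt).const_add _
  have hangle : ∀ t, deriv γ t = exp (θ t * I) := by
    have hd : ∀ t : ℝ, HasDerivAt (fun t => deriv γ t * exp (-θ t * I)) 0 t := fun t => by
      have h1 := ((hθ t).ofReal_comp.neg.mul_const I).cexp
      refine ((hγ2 t).mul h1).congr_deriv ?_
      rw [hfrenet]
      ring
    intro t
    have h0 : deriv γ 0 = exp (θ 0 * I) := by
      have := Complex.norm_mul_exp_arg_mul_I (deriv γ 0)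
      rw [hspeed, ofReal_one, one_mul] at this
      simp [hθdef, this]
    have h1 := is_const_of_deriv_eq_zero (fun x => (hd x).differentiableAt)
      (fun x => (hd x).deriv) t 0
    have h2 : ∀ z : ℂ, exp (z * I) * exp (-z * I) = 1 := fun z => by
      rw [← Complex.exp_add]; simp
    simp only [h0, h2] at h1
    refine mul_right_cancel₀ (Complex.exp_ne_zero (-θ t * I)) ?_
    rw [h1, h2]
  have := le_im_sub_mul_exp hk hper hinj (fun t => hangle t ▸ hγ1 t) hθ hcurv hκp ha hb
  have hconj : conj (deriv γ a) = exp (-θ a * I) := by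
    rw [hangle, ← Complex.exp_conj]
    simp
  rwa [hconj]

/-- The height of a simple closed unit-speed curve with curvature at least `k` over one of its
tangent lines, for either orientation. -/
theorem le_abs_im_sub_mul_conj_deriv {k : ℝ} (hk : 0 < k) {γ : ℝ → ℂ}
    (hper : Function.Periodic γ 1) (hsmooth : ContDiff ℝ 2 γ) (hinj : InjOn γ (Ico 0 1))
    (hspeed : ∀ t, ‖deriv γ t‖ = 1) (hcurv : ∀ t, k ≤ ‖deriv (deriv γ) t‖)
    {a t : ℝ} (ha : a ≤ t) (hb : t ≤ a + 1) :
    k / (2 * Real.pi) * (min (t - a) (a + 1 - t)) ^ 2 ≤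
      |((γ t - γ a) * conj (deriv γ a)).im| := by
  have hs1 : ContDiff ℝ 1 (deriv γ) :=
    (show ContDiff ℝ (1 + 1) γ by rwa [one_add_one_eq_two]).deriv'
  have hγ2 : ∀ t, HasDerivAt (deriv γ) (deriv (deriv γ) t) t := fun t =>
    (hs1.differentiable (by norm_num) t).hasDerivAt
  have hc2 : Continuous (deriv (deriv γ)) := hs1.continuous_deriv (by norm_num)
  set κ : ℝ → ℝ := fun t => (deriv (deriv γ) t * conj (deriv γ t)).im with hκ
  have hκc : Continuous κ :=
    Complex.continuous_im.comp (hc2.mul (Complex.continuous_conj.comp hs1.continuous))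
  have hκabs : ∀ t, k ≤ |κ t| := fun t => by
    have h5 : ‖deriv (deriv γ) t * conj (deriv γ t)‖ = |κ t| :=
      (abs_im_eq_norm.2 ((hγ2 t).re_mul_conj_eq_zero hspeed)).symm
    rw [norm_mul, Complex.norm_conj, hspeed, mul_one] at h5
    exact h5 ▸ hcurv t
  have hsign : (∀ t, k ≤ κ t) ∨ ∀ t, k ≤ -κ t := by
    have hne : ∀ t, κ t ≠ 0 := fun t h => by
      have := hκabs t
      rw [h, abs_zero] at this
      linarith
    by_cases hpos : ∀ t, 0 < κ t
    · exact Or.inl fun t => (hκabs t).trans_eq (abs_of_pos (hpos t))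
    · push Not at hpos
      obtain ⟨u, hu⟩ := hpos
      refine Or.inr fun t => (hκabs t).trans_eq (abs_of_nonpos ?_)
      by_contra! h
      obtain ⟨v, hv⟩ := mem_range_of_exists_le_of_exists_ge hκc ⟨u, hu⟩ ⟨t, h.le⟩
      exact hne v hv
  rcases hsign with hpos | hneg
  · exact (le_im_sub_mul_conj_deriv hk hper hsmooth hinj hspeed hpos ha hb).trans (le_abs_self _)
  · have hd : ∀ f : ℝ → ℂ, (deriv fun t => conj (f t)) = fun t => conj (deriv f t) :=
      fun f => deriv.star'
    have := le_im_sub_mul_conj_deriv (γ := fun t => conj (γ t)) hk (fun t => by simp only [hper t])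
      (Complex.conjCLE.contDiff.comp hsmooth)
      (fun x hx y hy hxy => hinj hx hy ((starRingEnd ℂ).injective hxy))
      (fun t => by rw [hd, Complex.norm_conj, hspeed])
      (fun t => by
        rw [hd, hd]
        simp only
        rw [← map_mul, Complex.conj_im]
        exact hneg t) ha hb
    rw [hd] at this
    simp only at this
    rw [← map_sub, ← map_mul, Complex.conj_im] at this
    exact this.trans (neg_le_abs _)

theorem stmt1 (k : ℝ) (hk : 0 < k) (γ : ℝ → ℂ)
    (hper : Function.Periodic γ 1) (hsmooth : ContDiff ℝ 2 γ)
    (hinj : Set.InjOn γ (Set.Ico 0 1))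
    -- unit length, constant (unit) speed parametrization
    (hspeed : ∀ t, ‖deriv γ t‖ = 1)
    -- curvature bounded below by `k`
    (hcurv : ∀ t, k ≤ ‖deriv (deriv γ) t‖)
    (t1 t2 : ℝ) (ht1 : t1 ∈ Set.Ico (0:ℝ) 1) (ht2 : t2 ∈ Set.Ico (0:ℝ) 1) :
    -- the distance from `γ t1` to the tangent line at `γ t2` is at least
    -- (k/2π) times the square of the length of the shorter arc joining them
    k / (2 * Real.pi) * (min |t1 - t2| (1 - |t1 - t2|)) ^ 2 ≤
      Metric.infDist (γ t1) {z : ℂ | ∃ s : ℝ, z = γ t2 + s • deriv γ t2} := by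
  have key : k / (2 * Real.pi) * (min |t1 - t2| (1 - |t1 - t2|)) ^ 2 ≤
      |((γ t1 - γ t2) * conj (deriv γ t2)).im| := by
    rcases le_total t2 t1 with h | h
    · have := le_abs_im_sub_mul_conj_deriv hk hper hsmooth hinj hspeed hcurv h
        (by linarith [ht1.2, ht2.1])
      rwa [abs_of_nonneg (sub_nonneg.2 h), show 1 - (t1 - t2) = t2 + 1 - t1 by ring]
    · have := le_abs_im_sub_mul_conj_deriv hk hper hsmooth hinj hspeed hcurv (a := t2)
        (t := t1 + 1) (by linarith [ht1.1, ht2.2]) (by linarith)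
      rwa [hper t1, min_comm, show t2 + 1 - (t1 + 1) = -(t1 - t2) by ring,
        show t1 + 1 - t2 = 1 - -(t1 - t2) by ring, ← abs_of_nonpos (sub_nonpos.2 h)] at this
  refine key.trans ((Metric.le_infDist ?_).2 ?_)
  · exact ⟨γ t2, 0, by simp⟩
  rintro _ ⟨s, rfl⟩
  have h1 : ((γ t1 - γ t2) * conj (deriv γ t2)).im =
      ((γ t1 - (γ t2 + s • deriv γ t2)) * conj (deriv γ t2)).im := by
    rw [← sub_sub, sub_mul (γ t1 - γ t2), Complex.real_smul, mul_assoc (s : ℂ),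
      Complex.mul_conj, ← ofReal_mul, sub_im, ofReal_im, sub_zero]
  rw [h1, dist_eq_norm]
  refine (Complex.abs_im_le_norm _).trans_eq ?_
  rw [norm_mul, Complex.norm_conj, hspeed, mul_one]
end

section
/- Let k > 0 and let C be a C²-smooth Jordan curve of unit length with curvature κ ≥ k everywhere. Then the length of the orthogonal projection of C onto any line is at least k/(8π). -/
open Complex in
theorem eq_of_exp_comp_eq {X : Type*} [TopologicalSpace X] {s : Set X} (hs : IsPreconnected s)
    {F : X → ℂ} (hF : ContinuousOn F s) {c : ℂ} (h : ∀ x ∈ s, exp (F x) = c)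
    {x y : X} (hx : x ∈ s) (hy : y ∈ s) : F x = F y :=
  isCoveringMap_exp.constOn_of_comp hs hF
    (fun a ha b hb => Subtype.ext ((h a ha).trans (h b hb).symm)) hx hy

open Complex in
theorem exists_continuous_exp_eq {X : Type*} [TopologicalSpace X] [SimplyConnectedSpace X]
    [LocallyPathConnectedSpace X] {G : X → ℂ} (hG : Continuous G) (h0 : ∀ x, G x ≠ 0) :
    ∃ L : X → ℂ, Continuous L ∧ ∀ x, exp (L x) = G x := by
  obtain ⟨x₀⟩ : Nonempty X := inferInstance
  obtain ⟨F, ⟨-, hF⟩, -⟩ := isCoveringMapOn_exp.existsUnique_continuousMap_lifts ⟨G, hG⟩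
    (a₀ := x₀) (e₀ := log (G x₀)) (exp_log (h0 x₀)) h0
  exact ⟨F, F.continuous, fun x => congrFun hF x⟩

open Complex in
theorem lift_sub_eq_log_sub {L : ℝ → ℂ} (hL : ContinuousOn L (Set.Icc 0 1)) {c : ℂ}
    (h : ∀ u ∈ Set.Icc (0 : ℝ) 1, c * exp (L u) ∈ slitPlane) :
    L 1 - L 0 = log (c * exp (L 1)) - log (c * exp (L 0)) := by
  have hc : c ≠ 0 := by
    rintro rfl
    simpa using h 0 (by simp)
  have key := eq_of_exp_comp_eq (isPreconnected_Icc (a := (0 : ℝ)) (b := 1))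
    (F := fun u => L u - log (c * exp (L u))) (c := c⁻¹)
    (hL.sub (ContinuousOn.clog (continuousOn_const.mul (continuous_exp.comp_continuousOn hL)) h))
    (fun u hu => by
      rw [exp_sub, exp_log (slitPlane_ne_zero (h u hu))]
      field_simp [exp_ne_zero (L u)])
    (x := 1) (y := 0) (by simp) (by simp)
  linear_combination key

/-- The mean of the derivative of `γ` over the segment from `s` to `s + h`, that is,
the slope of the secant. -/
noncomputable def meanSlope (γ : ℝ → ℂ) (s h : ℝ) : ℂ := ∫ u in (0 : ℝ)..1, deriv γ (s + u * h)

theorem continuous_meanSlope {γ : ℝ → ℂ} (hγ : Continuous (deriv γ)) :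
    Continuous fun p : ℝ × ℝ => meanSlope γ p.1 p.2 := by
  unfold meanSlope
  apply intervalIntegral.continuous_parametric_intervalIntegral_of_continuous'
  fun_prop

theorem mul_meanSlope {γ : ℝ → ℂ} (hd : Differentiable ℝ γ) (hγ : Continuous (deriv γ))
    (s h : ℝ) : h * meanSlope γ s h = γ (s + h) - γ s := by
  have hder : ∀ u ∈ Set.uIcc (0 : ℝ) 1,
      HasDerivAt (fun u : ℝ => γ (s + u * h)) (h • deriv γ (s + u * h)) u := fun u _ => by
    have h1 : HasDerivAt (fun u : ℝ => s + u * h) h u := by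
      simpa using ((hasDerivAt_id u).mul_const h).const_add s
    exact (hd _).hasDerivAt.scomp u h1
  have := intervalIntegral.integral_eq_sub_of_hasDerivAt hder
    (Continuous.intervalIntegrable (by fun_prop) _ _)
  simpa [meanSlope, intervalIntegral.integral_const_mul] using this

/-- The secant of a closed curve of period `1` from parameter `s` to `s + h`, rescaled so that it
extends continuously to `h = 0` and `h = 1`. -/
noncomputable def secant (γ : ℝ → ℂ) (s h : ℝ) : ℂ := meanSlope γ s h - meanSlope γ (s + 1) (h - 1)

theorem continuous_secant {γ : ℝ → ℂ} (hγ : Continuous (deriv γ)) :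
    Continuous fun p : ℝ × ℝ => secant γ p.1 p.2 :=
  (continuous_meanSlope hγ).sub
    ((continuous_meanSlope hγ).comp (g := fun p : ℝ × ℝ => meanSlope γ p.1 p.2)
      (f := fun p : ℝ × ℝ => (p.1 + 1, p.2 - 1)) (by fun_prop))

theorem Function.Periodic.deriv_add {γ : ℝ → ℂ} {c : ℝ} (hper : Function.Periodic γ c) :
    Function.Periodic (deriv γ) c := fun t => by
  rw [← deriv_comp_add_const]
  exact congrArg (fun f => deriv f t) (funext hper)

theorem mul_secant {γ : ℝ → ℂ} (hper : Function.Periodic γ 1)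
    (hd : Differentiable ℝ γ) (hγ : Continuous (deriv γ)) (s h : ℝ) :
    ((h * (1 - h) : ℝ) : ℂ) * secant γ s h = γ (s + h) - γ s := by
  have h1 := mul_meanSlope hd hγ s h
  have h2 := mul_meanSlope hd hγ (s + 1) (h - 1)
  rw [show s + 1 + (h - 1) = s + h by ring, hper s] at h2
  unfold secant
  push_cast at *
  linear_combination (1 - (h : ℂ)) * h1 + (h : ℂ) * h2

theorem secant_zero {γ : ℝ → ℂ} (hper : Function.Periodic γ 1)
    (hd : Differentiable ℝ γ) (hγ : Continuous (deriv γ)) (s : ℝ) : secant γ s 0 = deriv γ s := by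
  have h2 := mul_meanSlope hd hγ (s + 1) (0 - 1)
  rw [show s + 1 + (0 - 1) = s by ring, hper s] at h2
  simp at h2
  simp [secant, meanSlope] at h2 ⊢
  exact h2

theorem secant_one {γ : ℝ → ℂ} (hper : Function.Periodic γ 1)
    (hd : Differentiable ℝ γ) (hγ : Continuous (deriv γ)) (s : ℝ) : secant γ s 1 = -deriv γ s := by
  have h2 := mul_meanSlope hd hγ s 1
  have h3 : deriv γ (s + 1) = deriv γ s := hper.deriv_add s
  rw [hper s] at h2
  simp at h2
  simp [secant, h2]
  simp [meanSlope, h3]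

theorem secant_ne_zero {γ : ℝ → ℂ} (hper : Function.Periodic γ 1)
    (hd : Differentiable ℝ γ) (hγ : Continuous (deriv γ)) (hinj : Set.InjOn γ (Set.Ico 0 1))
    (h0 : ∀ t, deriv γ t ≠ 0) (s : ℝ) {h : ℝ} (hh : h ∈ Set.Icc (0 : ℝ) 1) : secant γ s h ≠ 0 := by
  rcases eq_or_lt_of_le hh.1 with rfl | hpos
  · rw [secant_zero hper hd hγ]
    exact h0 s
  rcases eq_or_lt_of_le hh.2 with rfl | hlt
  · rw [secant_one hper hd hγ]
    exact neg_ne_zero.2 (h0 s)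
  intro hz
  have h1 := mul_secant hper hd hγ s h
  rw [hz, mul_zero, eq_comm, sub_eq_zero] at h1
  have hfr : ∀ t, γ (Int.fract t) = γ t := fun t => by
    have := hper.sub_int_mul_eq (x := t) ⌊t⌋
    rwa [mul_one] at this
  have h2 := hinj ⟨Int.fract_nonneg _, Int.fract_lt_one _⟩ ⟨Int.fract_nonneg _, Int.fract_lt_one _⟩
    ((hfr (s + h)).trans (h1.trans (hfr s).symm))
  obtain ⟨z, hz⟩ := Int.fract_eq_fract.1 h2
  have hz' : h = z := by linarith
  rw [hz'] at hpos hlt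
  norm_cast at hpos hlt
  omega

open Complex in
theorem mem_slitPlane_of_re_nonneg {z : ℂ} (hz : z ≠ 0) (hre : 0 ≤ z.re) : z ∈ slitPlane := by
  rw [mem_slitPlane_iff]
  rcases hre.lt_or_eq with h | h
  · exact Or.inl h
  · exact Or.inr fun him => hz (Complex.ext h.symm him)

open Complex in
theorem two_mul_log_I_mul_sub {a : ℝ} (ha : a ≠ 0) :
    2 * (log (I * a) - log (-I * a)) = 2 * Real.pi * I ∨
      2 * (log (I * a) - log (-I * a)) = -(2 * Real.pi * I) := by
  rcases ha.lt_or_gt with h | h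
  · right
    have h1 : I * a = ((-a : ℝ) : ℂ) * -I := by push_cast; ring
    have h2 : -I * a = ((-a : ℝ) : ℂ) * I := by push_cast; ring
    rw [h1, h2, log_ofReal_mul (by linarith) (by simp), log_ofReal_mul (by linarith) (by simp),
      log_I, log_neg_I]
    ring
  · left
    rw [mul_comm I, mul_comm (-I), log_ofReal_mul h (by simp), log_ofReal_mul h (by simp),
      log_I, log_neg_I]
    ring

open Complex in
/-- Hopf's Umlaufsatz: the tangent angle of a simple closed curve changes by `2π` or `-2π` over
one period. -/
theorem tangent_log_add_one {γ : ℝ → ℂ} (hper : Function.Periodic γ 1) (hd : Differentiable ℝ γ)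
    (hγ : Continuous (deriv γ)) (hinj : Set.InjOn γ (Set.Ico 0 1)) {L : ℝ → ℂ}
    (hL : Continuous L) (hexp : ∀ t, exp (L t) = deriv γ t) :
    (∀ t, L (t + 1) = L t + 2 * Real.pi * I) ∨ (∀ t, L (t + 1) = L t - 2 * Real.pi * I) := by
  have h0 : ∀ t, deriv γ t ≠ 0 := fun t => hexp t ▸ exp_ne_zero _
  have hper' : ∀ t, deriv γ (t + 1) = deriv γ t := hper.deriv_add
  have hclamp : ∀ h : ℝ, max 0 (min h 1) ∈ Set.Icc (0 : ℝ) 1 := fun h =>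
    ⟨le_max_left _ _, max_le zero_le_one (min_le_right _ _)⟩
  have hclamp_eq : ∀ h ∈ Set.Icc (0 : ℝ) 1, max 0 (min h 1) = h := fun h hh => by
    rw [min_eq_left hh.2, max_eq_right hh.1]
  obtain ⟨M, hM, hMexp'⟩ := exists_continuous_exp_eq
    (G := fun p : ℝ × ℝ => secant γ p.1 (max 0 (min p.2 1)))
    ((continuous_secant hγ).comp (g := fun p : ℝ × ℝ => secant γ p.1 p.2)
      (f := fun p : ℝ × ℝ => (p.1, max 0 (min p.2 1))) (by fun_prop))
    (fun p => secant_ne_zero hper hd hγ hinj h0 p.1 (hclamp p.2))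
  have hMexp : ∀ s, ∀ h ∈ Set.Icc (0 : ℝ) 1, exp (M (s, h)) = secant γ s h := fun s h hh => by
    rw [hMexp', hclamp_eq h hh]
  have hsec0 : ∀ s, ∀ h ∈ Set.Icc (0 : ℝ) 1, secant γ s h ≠ 0 := fun s h hh =>
    secant_ne_zero hper hd hγ hinj h0 s hh
  obtain ⟨s, hs⟩ : ∃ s, ∀ t, (γ s).im ≤ (γ t).im := by
    have hcont : Continuous fun t => (γ t).im := continuous_im.comp hd.continuous
    obtain ⟨s, -, hs⟩ := isCompact_Icc.exists_isMinOn (Set.nonempty_Icc.2 (zero_le_one (α := ℝ)))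
      hcont.continuousOn
    refine ⟨s, fun t => ?_⟩
    obtain ⟨y, hy, hty⟩ := hper.exists_mem_Ico₀ one_pos t
    rw [hty]
    exact hs ⟨hy.1, hy.2.le⟩
  have him : (deriv γ s).im = 0 := by
    have hder : HasDerivAt (fun t => (γ t).im) (deriv γ s).im s :=
      (imCLM.hasFDerivAt.comp_hasDerivAt s (hd s).hasDerivAt)
    exact IsLocalMin.hasDerivAt_eq_zero (Filter.Eventually.of_forall hs) hder
  obtain ⟨a, ha⟩ : ∃ a : ℝ, deriv γ s = a := ⟨(deriv γ s).re, Complex.ext rfl (by simpa using him)⟩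
  have ha0 : a ≠ 0 := by
    rintro rfl
    exact h0 s (by simpa using ha)
  have himsec : ∀ s' h, (h * (1 - h)) * (secant γ s' h).im = (γ (s' + h)).im - (γ s').im :=
    fun s' h => by
      rw [← sub_im, ← mul_secant hper hd hγ s' h, im_ofReal_mul]
  have e00 : secant γ s 0 = a := by rw [secant_zero hper hd hγ, ha]
  have e01 : secant γ s 1 = -a := by rw [secant_one hper hd hγ, ha]
  have e10 : secant γ (s + 1) 0 = a := by rw [secant_zero hper hd hγ, hper', ha]
  have hup : ∀ u ∈ Set.Icc (0 : ℝ) 1, 0 ≤ (secant γ s u).im := fun u hu => by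
    rcases hu.1.eq_or_lt with rfl | hpos
    · simp [e00]
    rcases hu.2.eq_or_lt with rfl | hlt
    · simp [e01]
    refine nonneg_of_mul_nonneg_right (a := u * (1 - u)) ?_ (mul_pos hpos (by linarith))
    rw [himsec]
    linarith [hs (s + u)]
  have hdown : ∀ u ∈ Set.Icc (0 : ℝ) 1, (secant γ (s + u) (1 - u)).im ≤ 0 := fun u hu => by
    rcases hu.1.eq_or_lt with rfl | hpos
    · simp [e01]
    rcases hu.2.eq_or_lt with rfl | hlt
    · simp [e10]
    refine nonpos_of_mul_nonpos_right (a := (1 - u) * (1 - (1 - u))) ?_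
      (mul_pos (by linarith) (by linarith))
    rw [himsec, show s + u + (1 - u) = s + 1 by ring, hper]
    linarith [hs (s + u)]
  have hsymm : ∀ u ∈ Set.Icc (0 : ℝ) 1, 1 - u ∈ Set.Icc (0 : ℝ) 1 := fun u hu =>
    ⟨by linarith [hu.2], by linarith [hu.1]⟩
  have p1 := lift_sub_eq_log_sub (L := fun u => M (s, u)) (c := -I) (by fun_prop) fun u hu => by
    rw [hMexp s u hu]
    exact mem_slitPlane_of_re_nonneg (mul_ne_zero (by simp) (hsec0 s u hu))
      (by simpa using hup u hu)
  have p2 := lift_sub_eq_log_sub (L := fun u => M (s + u, 1 - u)) (c := I) (by fun_prop)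
    fun u hu => by
      rw [hMexp _ _ (hsymm u hu)]
      exact mem_slitPlane_of_re_nonneg (mul_ne_zero (by simp) (hsec0 _ _ (hsymm u hu)))
        (by simpa using hdown u hu)
  simp only [sub_self, sub_zero, add_zero] at p1 p2
  rw [hMexp _ _ (by simp), hMexp _ _ (by simp), e00, e01,
    show -I * -(a : ℂ) = I * a by ring] at p1
  rw [hMexp _ _ (by simp), hMexp _ _ (by simp), e10, e01,
    show I * -(a : ℂ) = -I * a by ring] at p2
  have hML := eq_of_exp_comp_eq isPreconnected_univ (F := fun t => M (t, 0) - L t) (c := 1)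
    (by fun_prop) (fun t _ => by
      rw [exp_sub, hexp, hMexp _ _ (by simp), secant_zero hper hd hγ, div_self (h0 t)])
    (Set.mem_univ (s + 1)) (Set.mem_univ s)
  have hLs : L (s + 1) - L s = 2 * (log (I * a) - log (-I * a)) := by
    linear_combination p1 + p2 - hML
  have hconst : ∀ t, L (t + 1) - L t = L (s + 1) - L s := fun t =>
    eq_of_exp_comp_eq isPreconnected_univ (F := fun t => L (t + 1) - L t) (c := 1)
      (by fun_prop) (fun t _ => by rw [exp_sub, hexp, hexp, hper', div_self (h0 t)])
      (Set.mem_univ t) (Set.mem_univ s)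
  refine (two_mul_log_I_mul_sub ha0).imp (fun h t => ?_) (fun h t => ?_)
  · linear_combination hconst t + hLs + h
  · linear_combination hconst t + hLs + h

open Real in
/-- On an arc along which the angle `ψ` grows by `π` at rate at least `k`, from `-π/2` to `π/2`, the
abscissa grows by at least `k ℓ² / (2π)`, where `ℓ` is the length of the arc. -/
theorem le_sub_of_angle_arc {k : ℝ} (hk : 0 ≤ k) {x ψ κ : ℝ → ℝ} {a b : ℝ} (hab : a ≤ b)
    (hx : ∀ t, HasDerivAt x (cos (ψ t)) t) (hψ : ∀ t, HasDerivAt ψ (κ t) t) (hκ : ∀ t, k ≤ κ t)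
    (ha : ψ a = -(π / 2)) (hb : ψ b = π / 2) : k * (b - a) ^ 2 / (2 * π) ≤ x b - x a := by
  have hmono : Monotone fun t => ψ t - k * t :=
    monotone_of_hasDerivAt_nonneg (f' := fun t => κ t - k)
      (fun t => (hψ t).sub (by simpa using (hasDerivAt_id t).const_mul k))
      (fun t => by simpa using hκ t)
  have hlow : ∀ t ∈ Set.Icc a b, -(π / 2) + k * (t - a) ≤ ψ t := fun t ht => by
    have := hmono ht.1
    simp only at this
    linarith
  have hupp : ∀ t ∈ Set.Icc a b, ψ t ≤ π / 2 - k * (b - t) := fun t ht => by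
    have := hmono ht.2
    simp only at this
    linarith
  have hcos : ∀ t ∈ Set.Icc a b, ∀ d, d ≤ k * (t - a) → d ≤ k * (b - t) →
      2 / π * d ≤ cos (ψ t) := fun t ht d h1 h2 => by
    have h3 := hlow t ht
    have h4 := hupp t ht
    have h5 : 0 ≤ k * (t - a) := mul_nonneg hk (by linarith [ht.1])
    have h6 : 0 ≤ k * (b - t) := mul_nonneg hk (by linarith [ht.2])
    have h7 : |ψ t| ≤ π / 2 - d := abs_le.2 ⟨by linarith, by linarith⟩
    have h8 : |ψ t| ≤ π / 2 := abs_le.2 ⟨by linarith, by linarith⟩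
    have h9 := one_sub_mul_le_cos (abs_nonneg (ψ t)) h8
    rw [cos_abs] at h9
    have h10 : 2 / π * |ψ t| ≤ 2 / π * (π / 2 - d) := by gcongr
    have h11 : 2 / π * (π / 2) = 1 := by field_simp
    linarith [mul_sub (2 / π) (π / 2) d]
  set m := (a + b) / 2 with hm
  have ham : a ≤ m := by linarith
  have hmb : m ≤ b := by linarith
  have hcont : Continuous x := continuous_iff_continuousAt.2 fun t => (hx t).continuousAt
  have m1 : MonotoneOn (fun t => x t - k / π * (t - a) ^ 2) (Set.Icc a m) := by
    refine monotoneOn_of_hasDerivWithinAt_nonneg (convex_Icc a m) (by fun_prop)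
      (f' := fun t => cos (ψ t) - k / π * (2 * (t - a))) (fun t ht => ?_) (fun t ht => ?_)
    · refine ((hx t).sub ?_).hasDerivWithinAt
      simpa using (((hasDerivAt_id t).sub_const a).pow 2).const_mul (k / π)
    · rw [interior_Icc] at ht
      have := hcos t ⟨ht.1.le, by linarith [ht.2]⟩ (k * (t - a)) le_rfl
        (mul_le_mul_of_nonneg_left (by linarith [ht.2]) hk)
      have e : 2 / π * (k * (t - a)) = k / π * (2 * (t - a)) := by ring
      linarith
  have m2 : MonotoneOn (fun t => x t + k / π * (b - t) ^ 2) (Set.Icc m b) := by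
    refine monotoneOn_of_hasDerivWithinAt_nonneg (convex_Icc m b) (by fun_prop)
      (f' := fun t => cos (ψ t) + k / π * (2 * (b - t) * -1)) (fun t ht => ?_) (fun t ht => ?_)
    · refine ((hx t).add ?_).hasDerivWithinAt
      simpa using (((hasDerivAt_id t).const_sub b).pow 2).const_mul (k / π)
    · rw [interior_Icc] at ht
      have := hcos t ⟨by linarith [ht.1], ht.2.le⟩ (k * (b - t))
        (mul_le_mul_of_nonneg_left (by linarith [ht.1]) hk) le_rfl
      have e : 2 / π * (k * (b - t)) = k / π * (2 * (b - t)) := by ring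
      linarith
  have i1 := m1 (Set.left_mem_Icc.2 ham) (Set.right_mem_Icc.2 ham) ham
  have i2 := m2 (Set.left_mem_Icc.2 hmb) (Set.right_mem_Icc.2 hmb) hmb
  simp only [hm] at i1 i2
  have e : k * (b - a) ^ 2 / (2 * π) =
    k / π * ((a + b) / 2 - a) ^ 2 + k / π * (b - (a + b) / 2) ^ 2 := by field_simp; ring
  rw [e]
  linarith

open Real in
theorem exists_le_abs_sub_of_angle {k : ℝ} (hk : 0 < k) {x ψ κ : ℝ → ℝ}
    (hx : ∀ t, HasDerivAt x (cos (ψ t)) t) (hψ : ∀ t, HasDerivAt ψ (κ t) t) (hκ : ∀ t, k ≤ κ t)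
    (hadd : ∀ t, ψ (t + 1) = ψ t + 2 * π) : ∃ a b, k / (8 * π) ≤ |x b - x a| := by
  have hcont : Continuous ψ := continuous_iff_continuousAt.2 fun t => (hψ t).continuousAt
  have hmono : StrictMono ψ := strictMono_of_hasDerivAt_pos hψ fun t => hk.trans_le (hκ t)
  have hnat : ∀ n : ℕ, ∀ t, ψ (t + n) = ψ t + n * (2 * π) := fun n => by
    induction n with
    | zero => simp
    | succ n ih =>
      intro t
      push_cast
      rw [← add_assoc, hadd, ih]
      ring
  have hsurj : ∀ y, ∃ t, ψ t = y := fun y => by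
    obtain ⟨n, hn⟩ := exists_nat_gt (|y - ψ 0| / (2 * π))
    rw [div_lt_iff₀ (by positivity), abs_lt] at hn
    have h1 := hnat n 0
    have h2 := hnat n (-n)
    rw [neg_add_cancel] at h2
    exact mem_range_of_exists_le_of_exists_ge hcont ⟨-n, by linarith⟩ ⟨0 + n, by linarith⟩
  obtain ⟨a, ha⟩ := hsurj (-(π / 2))
  obtain ⟨b, hb⟩ := hsurj (π / 2)
  have ha1 := hadd a
  have hab : a ≤ b := (hmono.le_iff_le).1 (by rw [ha, hb]; linarith [pi_pos])
  have hba : b ≤ a + 1 := (hmono.le_iff_le).1 (by rw [ha1, ha, hb]; linarith [pi_pos])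
  have hbound : ∀ l : ℝ, 1 / 2 ≤ l → k / (8 * π) ≤ k * l ^ 2 / (2 * π) := fun l hl => by
    have : k / (8 * π) = k * (1 / 2) ^ 2 / (2 * π) := by field_simp; norm_num
    rw [this]
    gcongr
  rcases le_total (1 / 2) (b - a) with h | h
  · exact ⟨a, b, (hbound _ h).trans
      ((le_sub_of_angle_arc hk.le hab hx hψ hκ ha hb).trans (le_abs_self _))⟩
  · have key := le_sub_of_angle_arc hk.le hba (x := fun t => -x t) (ψ := fun t => ψ t - π) (κ := κ)
      (fun t => by rw [cos_sub_pi]; exact (hx t).neg) (fun t => (hψ t).sub_const π) hκ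
      (by rw [hb]; ring) (by rw [ha1, ha]; ring)
    refine ⟨b, a + 1, (hbound (a + 1 - b) (by linarith)).trans (key.trans ?_)⟩
    rw [abs_sub_comm]
    exact le_trans (by linarith) (le_abs_self _)

open Complex in
/-- The derivative of a unit tangent field `T` is `i κ T` with `κ` real, the signed curvature. -/
theorem deriv_eq_curvature_mul {T : ℝ → ℂ} (hT : Differentiable ℝ T) (hnorm : ∀ t, ‖T t‖ = 1)
    (t : ℝ) : deriv T t = I * ((starRingEnd ℂ (T t) * deriv T t).im : ℂ) * T t := by
  have h1 : HasDerivAt (fun t => ‖T t‖ ^ 2) (2 * inner ℝ (T t) (deriv T t)) t :=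
    (hT t).hasDerivAt.norm_sq
  have h2 : HasDerivAt (fun t => ‖T t‖ ^ 2) 0 t := by
    simpa [hnorm] using hasDerivAt_const t (1 : ℝ)
  have h3 : (starRingEnd ℂ (T t) * deriv T t).re = 0 := by
    have := h1.unique h2
    rw [Complex.inner, mul_comm (deriv T t)] at this
    linarith
  have h4 : starRingEnd ℂ (T t) * deriv T t = I * ((starRingEnd ℂ (T t) * deriv T t).im : ℂ) := by
    conv_lhs => rw [← re_add_im (starRingEnd ℂ (T t) * deriv T t), h3]
    simp [mul_comm]
  have h5 : T t * starRingEnd ℂ (T t) = 1 := by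
    rw [mul_conj, normSq_eq_norm_sq, hnorm]
    simp
  rw [← h4]
  linear_combination (-deriv T t) * h5

open Complex in
theorem exists_angle {T : ℝ → ℂ} {κ : ℝ → ℝ} (hT : Differentiable ℝ T) (hnorm : ∀ t, ‖T t‖ = 1)
    (hκ : Continuous κ) (h : ∀ t, deriv T t = I * κ t * T t) :
    ∃ θ : ℝ → ℝ, (∀ t, HasDerivAt θ (κ t) t) ∧ ∀ t, exp (θ t * I) = T t := by
  have hθ : ∀ t, HasDerivAt (fun t => arg (T 0) + ∫ u in (0 : ℝ)..t, κ u) (κ t) t := fun t =>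
    (intervalIntegral.integral_hasDerivAt_right (hκ.intervalIntegrable _ _)
      (hκ.stronglyMeasurableAtFilter _ _) hκ.continuousAt).const_add _
  refine ⟨_, hθ, fun t => ?_⟩
  set θ : ℝ → ℝ := fun t => arg (T 0) + ∫ u in (0 : ℝ)..t, κ u with hθdef
  have hder : ∀ t, HasDerivAt (fun t => exp (-(θ t * I)) * T t) 0 t := fun t => by
    have h1 := (((hθ t).ofReal_comp.mul_const I).neg.cexp).mul (hT t).hasDerivAt
    refine h1.congr_deriv ?_
    rw [h, Pi.neg_apply]
    ring
  have hconst := is_const_of_deriv_eq_zero (fun t => (hder t).differentiableAt)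
    (fun t => (hder t).deriv) t 0
  have h0 : exp (θ 0 * I) = T 0 := by
    have := norm_mul_exp_arg_mul_I (T 0)
    rw [hnorm] at this
    simpa [hθdef] using this
  rw [← h0, ← exp_add, neg_add_cancel, exp_zero, exp_neg, inv_mul_eq_one₀ (exp_ne_zero _)] at hconst
  exact hconst

theorem le_or_le_neg_of_le_abs {k : ℝ} (hk : 0 < k) {κ : ℝ → ℝ} (hκ : Continuous κ)
    (h : ∀ t, k ≤ |κ t|) : (∀ t, k ≤ κ t) ∨ (∀ t, k ≤ -κ t) := by
  by_contra! ⟨⟨a, ha⟩, ⟨b, hb⟩⟩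
  have ha' : κ a ≤ 0 := by
    rcases le_abs.1 (h a) with h1 | h1 <;> linarith
  have hb' : 0 ≤ κ b := by
    rcases le_abs.1 (h b) with h1 | h1 <;> linarith
  obtain ⟨t, ht⟩ := mem_range_of_exists_le_of_exists_ge hκ ⟨a, ha'⟩ ⟨b, hb'⟩
  have := h t
  rw [ht, abs_zero] at this
  linarith

theorem stmt2 (k : ℝ) (hk : 0 < k) (γ : ℝ → ℂ)
    (hper : Function.Periodic γ 1) (hsmooth : ContDiff ℝ 2 γ)
    (hinj : Set.InjOn γ (Set.Ico 0 1))
    -- unit length, constant (unit) speed parametrization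
    (hspeed : ∀ t, ‖deriv γ t‖ = 1)
    -- curvature bounded below by `k`
    (hcurv : ∀ t, k ≤ ‖deriv (deriv γ) t‖) :
    -- the orthogonal projection of the curve onto any line (direction `v`)
    -- has length at least k/(8π)
    ∀ v : ℂ, ‖v‖ = 1 →
      k / (8 * Real.pi) ≤
        Metric.diam ((fun z : ℂ => (z * (starRingEnd ℂ) v).re) '' Set.range γ) := by
  intro v hv
  have hd : Differentiable ℝ γ := hsmooth.differentiable (by norm_num)
  have hT : ContDiff ℝ 1 (deriv γ) := (contDiff_succ_iff_deriv (n := 1).1 hsmooth).2.2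
  have hTd : Differentiable ℝ (deriv γ) := hT.differentiable (by norm_num)
  have hTT : Continuous (deriv (deriv γ)) := hT.continuous_deriv le_rfl
  have hTc : Continuous (deriv γ) := hT.continuous
  set κ : ℝ → ℝ := fun t => (starRingEnd ℂ (deriv γ t) * deriv (deriv γ) t).im with hκdef
  have hκ : Continuous κ := Complex.continuous_im.comp ((Complex.continuous_conj.comp hTc).mul hTT)
  have hκeq : ∀ t, deriv (deriv γ) t = Complex.I * κ t * deriv γ t :=
    deriv_eq_curvature_mul hTd hspeed
  have hκk : ∀ t, k ≤ |κ t| := fun t => by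
    simpa [hκeq t, hspeed t] using hcurv t
  obtain ⟨θ, hθ, hexp⟩ := exists_angle hTd hspeed hκ hκeq
  have hθc : Continuous θ := continuous_iff_continuousAt.2 fun t => (hθ t).continuousAt
  have hturn : (∀ t, θ (t + 1) = θ t + 2 * Real.pi) ∨ (∀ t, θ (t + 1) = θ t - 2 * Real.pi) := by
    refine (tangent_log_add_one hper hd hTc hinj (L := fun t => θ t * Complex.I) (by fun_prop)
      hexp).imp (fun h t => ?_) (fun h t => ?_)
    · simpa using congrArg Complex.im (h t)
    · simpa using congrArg Complex.im (h t)
  have hx : ∀ t, HasDerivAt (fun t => (γ t * starRingEnd ℂ v).re)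
      (Real.cos (θ t - Complex.arg v)) t := fun t => by
    have h1 := Complex.reCLM.hasFDerivAt.comp_hasDerivAt t
      ((hd t).hasDerivAt.mul_const (starRingEnd ℂ v))
    have h2 : Complex.exp (Complex.arg v * Complex.I) = v := by
      simpa [hv] using Complex.norm_mul_exp_arg_mul_I v
    have h3 : deriv γ t * starRingEnd ℂ v =
        Complex.exp ((θ t - Complex.arg v : ℝ) * Complex.I) := by
      conv_lhs => rw [← hexp t, ← h2, ← Complex.exp_conj, ← Complex.exp_add]
      congr 1
      simp
      ring
    rw [h3] at h1
    rw [Complex.reCLM_apply, Complex.exp_ofReal_mul_I_re] at h1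
    exact h1
  have hwidth : ∃ a b, k / (8 * Real.pi) ≤
      |(γ b * starRingEnd ℂ v).re - (γ a * starRingEnd ℂ v).re| := by
    rcases le_or_le_neg_of_le_abs hk hκ hκk with hpos | hneg
    · have hmono : StrictMono θ := strictMono_of_hasDerivAt_pos hθ fun t => hk.trans_le (hpos t)
      have hturn' := hturn.resolve_right fun h => by
        linarith [h 0, hmono (show (0 : ℝ) < 0 + 1 by norm_num), Real.pi_pos]
      exact exists_le_abs_sub_of_angle hk hx (fun t => (hθ t).sub_const _) hpos
        (fun t => by rw [hturn' t]; ring)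
    · have hmono : StrictMono (-θ) :=
        strictMono_of_hasDerivAt_pos (fun t => (hθ t).neg) fun t => hk.trans_le (hneg t)
      have hturn' := hturn.resolve_left fun h => by
        have := hmono (show (0 : ℝ) < 0 + 1 by norm_num)
        simp only [Pi.neg_apply] at this
        linarith [h 0, Real.pi_pos]
      refine exists_le_abs_sub_of_angle hk (ψ := fun t => -(θ t - Complex.arg v))
        (fun t => by rw [Real.cos_neg]; exact hx t) (fun t => ((hθ t).sub_const _).neg) hneg
        (fun t => by rw [hturn' t]; ring)
  obtain ⟨a, b, hab⟩ := hwidth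
  have hcont : Continuous fun t => (γ t * starRingEnd ℂ v).re :=
    continuous_iff_continuousAt.2 fun t => (hx t).continuousAt
  have hcompact : IsCompact ((fun z : ℂ => (z * (starRingEnd ℂ) v).re) '' Set.range γ) :=
    (hper.compact_of_continuous one_ne_zero hd.continuous).image (by fun_prop)
  rw [← Real.dist_eq] at hab
  exact hab.trans (Metric.dist_le_diam_of_mem hcompact.isBounded
    (Set.mem_image_of_mem _ ⟨b, rfl⟩) (Set.mem_image_of_mem _ ⟨a, rfl⟩))
end

section
/- For every open set Ω ⊂ ℝ², there exists a packing of Ω by convex smooth Jordan curves whose residual set has σ-finite 1-dimensional Hausdorff measure; in particular its Hausdorff dimension equals 1. -/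
def IsJordanCurve (C : Set ℂ) : Prop :=
  ∃ γ : ℝ → ℂ, Function.Periodic γ 1 ∧ Continuous γ ∧
    Set.InjOn γ (Set.Ico 0 1) ∧ Set.range γ = C

def IsJordanRegion (D : Set ℂ) : Prop :=
  IsOpen D ∧ IsConnected D ∧ Bornology.IsBounded D ∧ IsJordanCurve (frontier D)

/-- A smooth (C²) Jordan curve. -/
def IsSmoothJordanCurve (C : Set ℂ) : Prop :=
  ∃ γ : ℝ → ℂ, Function.Periodic γ 1 ∧ ContDiff ℝ 2 γ ∧ (∀ t, deriv γ t ≠ 0) ∧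
    Set.InjOn γ (Set.Ico 0 1) ∧ Set.range γ = C

open Set Filter Topology
open scoped ENNReal NNReal

theorem ConvexOn.lt_of_lt_of_eq_of_lt {g : ℝ → ℝ} (hg : ConvexOn ℝ univ g) {τ : ℝ}
    (h0 : g 0 < τ) {s t : ℝ} (hs : 0 < s) (hst : s < t) (h : g s = τ) : τ < g t := by
  have h1 := hg.slope_mono_adjacent (mem_univ 0) (mem_univ t) hs hst
  have h2 : 0 < (g s - g 0) / (s - 0) := by apply div_pos <;> linarith
  have h3 := lt_of_lt_of_le h2 h1
  rw [div_pos_iff_of_pos_right (by linarith)] at h3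
  linarith

section
variable {F : ℂ → ℝ} {c : ℂ} {τ : ℝ}

theorem ray_convexOn (hF : ConvexOn ℝ univ F) (c u : ℂ) :
    ConvexOn ℝ univ fun t : ℝ => F (c + t * u) := by
  refine ⟨convex_univ, fun x _ y _ a b ha hb hab => ?_⟩
  have := hF.2 (mem_univ (c + x * u)) (mem_univ (c + y * u)) ha hb hab
  convert this using 2
  have : (a : ℂ) + b = 1 := by exact_mod_cast hab
  simp only [smul_eq_mul, Complex.real_smul, Complex.ofReal_add, Complex.ofReal_mul]
  linear_combination (-c) * this

theorem exists_ray_eq (hFc : Continuous F) (hc : F c < τ)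
    (hb : Bornology.IsBounded {z | F z < τ}) (u : ℂ) (hu : ‖u‖ = 1) :
    ∃ t : ℝ, 0 < t ∧ F (c + t * u) = τ := by
  obtain ⟨R, hR0, hR⟩ := hb.exists_pos_norm_lt
  set T := R + ‖c‖ with hT
  have hT0 : 0 < T := by positivity
  have h1 : τ ≤ F (c + T * u) := by
    by_contra! h
    have h2 := hR _ h
    have h3 : ‖(T : ℂ) * u‖ = T := by
      rw [norm_mul, hu, mul_one, Complex.norm_real, Real.norm_of_nonneg hT0.le]
    have h4 : ‖(T : ℂ) * u‖ ≤ ‖c + T * u‖ + ‖c‖ := by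
      have := norm_sub_le (c + T * u) c
      simpa using this
    linarith
  have hcont : ContinuousOn (fun t : ℝ => F (c + t * u)) (Icc 0 T) := by fun_prop
  obtain ⟨t, ht, hte⟩ := intermediate_value_Icc hT0.le hcont
    (show τ ∈ Icc _ _ from ⟨by simpa using hc.le, h1⟩)
  refine ⟨t, lt_of_le_of_ne ht.1 ?_, hte⟩
  rintro rfl
  simp at hte
  linarith

theorem ray_unique (hF : ConvexOn ℝ univ F) (hc : F c < τ) {u : ℂ} {s t : ℝ} (hs : 0 < s)
    (ht : 0 < t) (h1 : F (c + s * u) = τ) (h2 : F (c + t * u) = τ) : s = t := by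
  have hg := ray_convexOn hF c u
  have h0 : (fun t : ℝ => F (c + t * u)) 0 < τ := by simpa using hc
  rcases lt_trichotomy s t with h | h | h
  · have := ConvexOn.lt_of_lt_of_eq_of_lt hg h0 hs h h1
    simp only [h2] at this
    exact absurd this (lt_irrefl _)
  · exact h
  · have := ConvexOn.lt_of_lt_of_eq_of_lt hg h0 ht h h2
    simp only [h1] at this
    exact absurd this (lt_irrefl _)

theorem frontier_sublevel (hFc : Continuous F) (hF : ConvexOn ℝ univ F) (hc : F c < τ) :
    frontier {z | F z < τ} = {z | F z = τ} := by
  apply (frontier_lt_subset_eq hFc continuous_const).antisymm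
  intro z hz
  have hz : F z = τ := hz
  have hop : IsOpen {z | F z < τ} := isOpen_lt hFc continuous_const
  rw [hop.frontier_eq]
  refine ⟨?_, fun h => ?_⟩
  · have hlim : Tendsto (fun t : ℝ => c + t * (z - c)) (𝓝[<] 1) (𝓝 z) := by
      have : Continuous (fun t : ℝ => c + t * (z - c)) := by fun_prop
      have := (this.tendsto 1).mono_left (nhdsWithin_le_nhds (s := Iio 1))
      simpa using this
    refine mem_closure_of_tendsto hlim ?_
    filter_upwards [Ioo_mem_nhdsLT (zero_lt_one' ℝ)] with t ht
    have hg := ray_convexOn hF c (z - c)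
    have := hg.2 (mem_univ 0) (mem_univ 1) (sub_nonneg.2 ht.2.le) ht.1.le (by ring)
    simp [hz] at this
    show F _ < τ
    nlinarith [ht.1, ht.2]
  · have h : F z < τ := h
    linarith

theorem contDiff_radius (hFs : ContDiff ℝ 2 F) (hF : ConvexOn ℝ univ F) (hc : F c < τ)
    {e : ℝ → ℂ} (he : ContDiff ℝ 2 e) {r : ℝ → ℝ} (hr : ∀ t, 0 < r t)
    (hre : ∀ t, F (c + r t * e t) = τ) : ContDiff ℝ 2 r := by
  rw [contDiff_iff_contDiffAt]
  intro t
  set G : ℝ × ℝ → ℝ := fun p => F (c + p.2 * e p.1) with hG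
  have hGs : ContDiff ℝ 2 G := by
    apply hFs.comp
    apply contDiff_const.add
    apply ContDiff.mul
    · exact Complex.ofRealCLM.contDiff.comp contDiff_snd
    · exact he.comp contDiff_fst
  have hGa : ContDiffAt ℝ 2 G (t, r t) := hGs.contDiffAt
  set g : ℝ → ℝ := fun s => F (c + s * e t) with hg
  have hgc : ConvexOn ℝ univ g := ray_convexOn hF c (e t)
  have hgd : HasDerivAt g (fderiv ℝ G (t, r t) (0, 1)) (r t) := by
    have h1 := (hGs.differentiable (by norm_num) (t, r t)).hasFDerivAt
    have h2 : HasDerivAt (fun s : ℝ => (t, s)) ((0 : ℝ), (1 : ℝ)) (r t) :=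
      (hasDerivAt_const _ _).prodMk (hasDerivAt_id _)
    exact h1.comp_hasDerivAt (r t) h2
  have hpos : 0 < fderiv ℝ G (t, r t) (0, 1) := by
    have h0 : g 0 < τ := by simpa [hg] using hc
    have := hgc.slope_le_of_hasDerivAt (mem_univ 0) (mem_univ (r t)) (hr t) hgd
    refine lt_of_lt_of_le ?_ this
    rw [slope_def_field]
    apply div_pos
    · rw [show g (r t) = τ from hre t]; linarith
    · linarith [hr t]
  have hinv : (fderiv ℝ G (t, r t) ∘L .inr ℝ ℝ ℝ).IsInvertible := by
    refine ⟨ContinuousLinearEquiv.unitsEquivAut ℝ (Units.mk0 _ hpos.ne'), ?_⟩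
    ext
    simp
  have hA := hGa.contDiffAt_implicitFunction (by norm_num) hinv
  refine hA.congr_of_eventuallyEq ?_
  have hB := hGa.eventually_apply_implicitFunction (by norm_num) hinv
  have hC : ∀ᶠ x in 𝓝 t, 0 < hGa.implicitFunction (by norm_num) hinv x := by
    apply hA.continuousAt.eventually_const_lt
    rw [hGa.implicitFunction_apply_self (by norm_num) hinv]
    exact hr t
  filter_upwards [hB, hC] with x hx hx'
  refine ray_unique hF hc (hr x) hx' (hre x) (u := e x) ?_
  rw [← hre t]
  exact hx

theorem smooth_sublevel (hFs : ContDiff ℝ 2 F) (hF : ConvexOn ℝ univ F) (hc : F c < τ)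
    (hb : Bornology.IsBounded {z | F z < τ}) : IsSmoothJordanCurve {z | F z = τ} := by
  have hex := exists_ray_eq hFs.continuous hc hb
  set e : ℝ → ℂ := fun t => Complex.exp ((2 * Real.pi * t : ℝ) * Complex.I) with he_def
  have he1 : ∀ t, ‖e t‖ = 1 := fun t => Complex.norm_exp_ofReal_mul_I _
  choose ρ hρ0 hρ using hex
  set r : ℝ → ℝ := fun t => ρ (e t) (he1 t) with hr_def
  have hr0 : ∀ t, 0 < r t := fun t => hρ0 _ _
  have hr : ∀ t, F (c + r t * e t) = τ := fun t => hρ _ _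
  have hes : ContDiff ℝ 2 e := by
    apply ContDiff.cexp
    apply ContDiff.mul _ contDiff_const
    exact Complex.ofRealCLM.contDiff.comp (contDiff_const.mul contDiff_id)
  have hrs : ContDiff ℝ 2 r := contDiff_radius hFs hF hc hes hr0 hr
  have hper : Function.Periodic e 1 := by
    intro t
    simp only [he_def]
    rw [Complex.exp_eq_exp_iff_exists_int]
    refine ⟨1, ?_⟩
    push_cast
    ring
  have hreq : ∀ s t, e s = e t → r s = r t := by
    intro s t h
    simp only [hr_def]
    congr 1
  refine ⟨fun t => c + r t * e t, ?_, ?_, ?_, ?_, ?_⟩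
  · intro t
    simp only [hper t, hreq _ _ (hper t)]
  · exact contDiff_const.add ((Complex.ofRealCLM.contDiff.comp hrs).mul hes)
  · intro t
    have h1 : HasDerivAt r (deriv r t) t :=
      (hrs.differentiable (by norm_num) t).hasDerivAt
    have h2 : HasDerivAt e (e t * ((2 * Real.pi : ℝ) * Complex.I)) t := by
      have h3 : HasDerivAt (fun t : ℝ => ((2 * Real.pi * t : ℝ) : ℂ) * Complex.I)
          ((2 * Real.pi : ℝ) * Complex.I) t := by
        have : HasDerivAt (fun t : ℝ => 2 * Real.pi * t) (2 * Real.pi) t := by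
          simpa using (hasDerivAt_id t).const_mul (2 * Real.pi)
        exact this.ofReal_comp.mul_const _
      exact h3.cexp
    have h4 := (h1.ofReal_comp.mul h2).const_add c
    have h5 : (fun t => c + (r t : ℂ) * e t) = fun x => c + ((fun y : ℝ => (r y : ℂ)) * e) x := rfl
    rw [h5, h4.deriv]
    have : ((deriv r t : ℝ) : ℂ) * e t + r t * (e t * ((2 * Real.pi : ℝ) * Complex.I)) =
      e t * (((deriv r t : ℝ) : ℂ) + (2 * Real.pi * r t : ℝ) * Complex.I) := by push_cast; ring
    rw [this]
    apply mul_ne_zero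
    · rw [← norm_ne_zero_iff, he1]; norm_num
    · intro h
      have := congrArg Complex.im h
      simp [Real.pi_ne_zero, (hr0 t).ne'] at this
  · intro s hs t ht h
    have h : c + (r s : ℂ) * e s = c + r t * e t := h
    have h' := add_left_cancel h
    have hn := congrArg norm h'
    simp only [norm_mul, he1, mul_one, Complex.norm_real, Real.norm_of_nonneg (hr0 _).le] at hn
    rw [hn] at h'
    have hee := mul_left_cancel₀ (by exact_mod_cast (hr0 t).ne') h'
    simp only [he_def] at hee
    rw [Complex.exp_eq_exp_iff_exists_int] at hee
    obtain ⟨n, hn⟩ := hee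
    have him := congrArg Complex.im hn
    simp at him
    have h7 : s = t + n := by
      have := Real.pi_pos
      have h8 : (2 * Real.pi) * (s - t - n) = 0 := by linarith
      rcases mul_eq_zero.1 h8 with h | h <;> linarith
    have h9 : n = 0 := by
      have a1 : (n : ℝ) < 1 := by linarith [hs.2, ht.1]
      have a2 : (-1 : ℝ) < n := by linarith [hs.1, ht.2]
      have a3 : n < 1 := by exact_mod_cast a1
      have a4 : -1 < n := by exact_mod_cast a2
      omega
    simpa [h9] using h7
  · ext z
    constructor
    · rintro ⟨t, rfl⟩
      exact hr t
    · intro hz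
      have hz : F z = τ := hz
      have hzc : z - c ≠ 0 := by
        intro h
        rw [sub_eq_zero.1 h] at hz
        linarith
      refine ⟨Complex.arg (z - c) / (2 * Real.pi), ?_⟩
      set t := Complex.arg (z - c) / (2 * Real.pi) with ht
      have h1 : ((‖z - c‖ : ℝ) : ℂ) * e t = z - c := by
        have : 2 * Real.pi * t = Complex.arg (z - c) := by
          rw [ht]; field_simp
        simp only [he_def, this]
        exact Complex.norm_mul_exp_arg_mul_I _
      have h2 : r t = ‖z - c‖ := by
        refine ray_unique hF hc (hr0 t) (norm_pos_iff.2 hzc) (hr t) (u := e t) ?_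
        rw [h1]; simpa using hz
      simp only [h2, h1]
      ring
end

theorem contDiff_max_zero_pow_three : ContDiff ℝ 2 (fun t : ℝ => (max 0 t) ^ 3) := by
  have h : ∀ n : ℕ, ∀ t : ℝ,
      HasDerivAt (fun t : ℝ => (max 0 t) ^ (n+2)) ((n + 2) * (max 0 t) ^ (n+1)) t := by
    intro n t
    rcases lt_trichotomy t 0 with ht | ht | ht
    · have : (fun t : ℝ => (max 0 t) ^ (n+2)) =ᶠ[𝓝 t] fun _ => 0 := by
        filter_upwards [gt_mem_nhds ht] with x hx
        simp [max_eq_left hx.le]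
      rw [max_eq_left ht.le]
      simpa using (hasDerivAt_const t (0:ℝ)).congr_of_eventuallyEq this
    · subst ht
      rw [hasDerivAt_iff_isLittleO]
      simp only [max_self, sub_zero, ne_eq, Nat.add_eq_zero_iff, OfNat.ofNat_ne_zero,
        and_false, not_false_eq_true, zero_pow, one_ne_zero, mul_zero, smul_eq_mul]
      have h2 : (fun t : ℝ => (max 0 t) ^ (n+2)) =O[𝓝 0] fun t : ℝ => t ^ (n+2) := by
        apply Asymptotics.IsBigO.of_bound 1
        filter_upwards with x
        rw [norm_pow, norm_pow, one_mul]
        gcongr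
        rw [Real.norm_eq_abs, Real.norm_eq_abs, abs_of_nonneg (le_max_left _ _)]
        exact max_le (abs_nonneg _) (le_abs_self _)
      refine h2.trans_isLittleO ?_
      simpa using Asymptotics.isLittleO_pow_pow (𝕜 := ℝ) (show 1 < n + 2 by omega)
    · have : (fun t : ℝ => (max 0 t) ^ (n+2)) =ᶠ[𝓝 t] fun t => t ^ (n+2) := by
        filter_upwards [lt_mem_nhds ht] with x hx
        simp [max_eq_right hx.le]
      rw [max_eq_right ht.le]
      simpa using (hasDerivAt_pow (n+2) t).congr_of_eventuallyEq this
  have h1 : ContDiff ℝ 1 (fun t : ℝ => (max 0 t) ^ 2) := by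
    rw [show (1 : WithTop ℕ∞) = 0 + 1 by rfl, contDiff_succ_iff_deriv]
    refine ⟨fun t => (h 0 t).differentiableAt, by simp, ?_⟩
    rw [show deriv (fun t : ℝ => (max 0 t) ^ 2) = _ from funext fun t => (h 0 t).deriv]
    rw [contDiff_zero]
    fun_prop
  rw [show (2 : WithTop ℕ∞) = 1 + 1 by norm_num, contDiff_succ_iff_deriv]
  refine ⟨fun t => (h 1 t).differentiableAt, by simp, ?_⟩
  rw [show deriv (fun t : ℝ => (max 0 t) ^ 3) = _ from funext fun t => (h 1 t).deriv]
  exact contDiff_const.mul h1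

theorem convexOn_max_zero_pow_three : ConvexOn ℝ univ (fun t : ℝ => (max 0 t) ^ 3) := by
  have : ConvexOn ℝ univ (fun t : ℝ => (max 0 t)) :=
    (convexOn_const 0 convex_univ).sup (convexOn_id convex_univ)
  exact this.pow (fun x _ => le_max_left _ _) 3

/-- A Jordan region with smooth boundary and convex closure. -/
def IsGoodRegion (D : Set ℂ) : Prop :=
  IsJordanRegion D ∧ IsSmoothJordanCurve (frontier D) ∧ Convex ℝ (closure D)

theorem IsSmoothJordanCurve.isJordanCurve {C : Set ℂ} (h : IsSmoothJordanCurve C) :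
    IsJordanCurve C := by
  obtain ⟨γ, h1, h2, -, h3, h4⟩ := h
  exact ⟨γ, h1, h2.continuous, h3, h4⟩

theorem good_sublevel {F : ℂ → ℝ} {c : ℂ} {τ : ℝ} (hFs : ContDiff ℝ 2 F)
    (hF : ConvexOn ℝ univ F) (hc : F c < τ)
    (hb : Bornology.IsBounded {z | F z < τ}) : IsGoodRegion {z | F z < τ} := by
  have hconv : Convex ℝ {z | F z < τ} := by simpa using hF.convex_lt τ
  have hfr : IsSmoothJordanCurve (frontier {z | F z < τ}) := by
    rw [frontier_sublevel hFs.continuous hF hc]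
    exact smooth_sublevel hFs hF hc hb
  exact ⟨⟨isOpen_lt hFs.continuous continuous_const, hconv.isConnected ⟨c, hc⟩, hb,
    hfr.isJordanCurve⟩, hfr, hconv.closure⟩

/-- A `C²` convex function vanishing exactly on `[-b, b]`. -/
def wall (b x : ℝ) : ℝ := (max 0 (x - b)) ^ 3 + (max 0 (-x - b)) ^ 3

theorem wall_eq {b : ℝ} (hb : 0 ≤ b) (x : ℝ) : wall b x = (max 0 (|x| - b)) ^ 3 := by
  unfold wall
  rcases le_total 0 x with h | h
  · rw [abs_of_nonneg h, max_eq_left (show -x - b ≤ 0 by linarith)]; simp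
  · rw [abs_of_nonpos h, max_eq_left (show x - b ≤ 0 by linarith)]; simp

theorem contDiff_wall (b : ℝ) : ContDiff ℝ 2 (wall b) :=
  (contDiff_max_zero_pow_three.comp (contDiff_id.sub contDiff_const)).add
    (contDiff_max_zero_pow_three.comp (contDiff_id.neg.sub contDiff_const))

theorem convexOn_wall (b : ℝ) : ConvexOn ℝ univ (wall b) := by
  have h : ∀ k c : ℝ, ConvexOn ℝ univ fun x : ℝ => (max 0 (k * x + c)) ^ 3 := by
    intro k c
    refine ⟨convex_univ, fun x _ y _ a b ha hb hab => ?_⟩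
    have := convexOn_max_zero_pow_three.2 (mem_univ (k * x + c)) (mem_univ (k * y + c)) ha hb hab
    have key : a • (k * x + c) + b • (k * y + c) = k * (a • x + b • y) + c := by
      simp only [smul_eq_mul]
      linear_combination c * hab
    rwa [key] at this
  have hsum : wall b = (fun x => max 0 (1 * x + -b) ^ 3) + fun x => max 0 (-1 * x + -b) ^ 3 := by
    ext x
    simp [wall, sub_eq_add_neg]
  rw [hsum]
  exact (h 1 (-b)).add (h (-1) (-b))

theorem wall_nonneg (b x : ℝ) : 0 ≤ wall b x := by unfold wall; positivity

theorem wall_lt_iff {b δ : ℝ} (hb : 0 ≤ b) (hδ : 0 < δ) (x : ℝ) :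
    wall b x < δ ^ 3 ↔ |x| < b + δ := by
  rw [wall_eq hb, pow_lt_pow_iff_left₀ (le_max_left _ _) hδ.le (by norm_num), max_lt_iff]
  constructor
  · rintro ⟨-, h⟩; linarith
  · intro h; exact ⟨hδ, by linarith⟩

theorem wall_pos_iff {b : ℝ} (hb : 0 ≤ b) (x : ℝ) : 0 < wall b x ↔ b < |x| := by
  rw [wall_eq hb]
  constructor
  · intro h
    by_contra! h'
    rw [max_eq_left (by linarith)] at h
    simp at h
  · intro h
    have : 0 < max 0 (|x| - b) := lt_max_of_lt_right (by linarith)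
    positivity

/-- The open axis-parallel square with centre `a` and side length `2 * s`. -/
def openSquare (a : ℂ) (s : ℝ) : Set ℂ := {z | |z.re - a.re| < s ∧ |z.im - a.im| < s}

/-- The closed axis-parallel square with centre `a` and side length `2 * s`. -/
def closedSquare (a : ℂ) (s : ℝ) : Set ℂ := {z | |z.re - a.re| ≤ s ∧ |z.im - a.im| ≤ s}

theorem isOpen_openSquare (a : ℂ) (s : ℝ) : IsOpen (openSquare a s) :=
  (isOpen_lt (f := fun z : ℂ => |z.re - a.re|) (by fun_prop) continuous_const).inter
    (isOpen_lt (f := fun z : ℂ => |z.im - a.im|) (by fun_prop) continuous_const)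

theorem isClosed_closedSquare (a : ℂ) (s : ℝ) : IsClosed (closedSquare a s) :=
  (isClosed_le (f := fun z : ℂ => |z.re - a.re|) (by fun_prop) continuous_const).inter
    (isClosed_le (f := fun z : ℂ => |z.im - a.im|) (by fun_prop) continuous_const)

theorem openSquare_subset (a : ℂ) (s : ℝ) : openSquare a s ⊆ closedSquare a s :=
  fun _ h => ⟨h.1.le, h.2.le⟩

theorem closedSquare_subset_closedBall (a : ℂ) (s : ℝ) :
    closedSquare a s ⊆ Metric.closedBall a (2 * s) := by
  intro z hz
  rw [mem_closedBall_iff_norm]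
  refine (Complex.norm_le_abs_re_add_abs_im _).trans ?_
  simp only [Complex.sub_re, Complex.sub_im]
  linarith [hz.1, hz.2]

theorem exists_sign {b s x : ℝ} (h1 : b ≤ |x|) (h2 : |x| ≤ s) :
    ∃ i : Bool, |x - (if i then s else -s)| ≤ s - b := by
  rcases le_total 0 x with h | h
  · refine ⟨true, ?_⟩
    rw [abs_of_nonneg h] at h1 h2
    rw [abs_le]; constructor <;> simp <;> linarith
  · refine ⟨false, ?_⟩
    rw [abs_of_nonpos h] at h1 h2
    rw [abs_le]; constructor <;> simp <;> linarith

theorem exists_region_in_square (a : ℂ) {s δ : ℝ} (hδ : 0 < δ) (hs : δ < s) :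
    ∃ D V : Set ℂ, IsGoodRegion D ∧ D ⊆ openSquare a s ∧ IsOpen V ∧ V.Nonempty ∧
      V ⊆ openSquare a s ∧ Disjoint D V ∧ openSquare a s ⊆ D ∪ V ∪ frontier D ∧
      ∃ t : Bool × Bool → Set ℂ, V ⊆ ⋃ i, t i ∧
        ∀ i, Metric.ediam (t i) ≤ ENNReal.ofReal (4 * δ) := by
  set b := s - δ with hb_def
  have hb : 0 ≤ b := by linarith
  have hbs : b + δ = s := by ring
  set F : ℂ → ℝ := fun z => wall b (z.re - a.re) + wall b (z.im - a.im) with hF_def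
  have hFs : ContDiff ℝ 2 F :=
    ((contDiff_wall b).comp (Complex.reCLM.contDiff.sub contDiff_const)).add
      ((contDiff_wall b).comp (Complex.imCLM.contDiff.sub contDiff_const))
  have hF : ConvexOn ℝ univ F := by
    have h : ∀ (L : ℂ →ₗ[ℝ] ℝ) (k : ℝ), ConvexOn ℝ univ fun z => wall b (L z - k) := by
      intro L k
      refine ⟨convex_univ, fun x _ y _ p q hp hq hpq => ?_⟩
      have := (convexOn_wall b).2 (mem_univ (L x - k)) (mem_univ (L y - k)) hp hq hpq
      convert this using 2
      simp only [map_add, map_smul, smul_eq_mul]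
      linear_combination k * hpq
    exact (h Complex.reLm a.re).add (h Complex.imLm a.im)
  have hc : F a < δ ^ 3 := by
    have : F a = 0 := by simp [hF_def, wall_eq hb, hb]
    rw [this]; positivity
  have hsub : {z | F z < δ ^ 3} ⊆ openSquare a s := by
    intro z hz
    have hz : wall b (z.re - a.re) + wall b (z.im - a.im) < δ ^ 3 := hz
    have h1 := wall_nonneg b (z.re - a.re)
    have h2 := wall_nonneg b (z.im - a.im)
    constructor
    · rw [← hbs, ← wall_lt_iff hb hδ]; linarith
    · rw [← hbs, ← wall_lt_iff hb hδ]; linarith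
  have hbd : Bornology.IsBounded {z | F z < δ ^ 3} :=
    Metric.isBounded_closedBall.subset
      ((hsub.trans (openSquare_subset a s)).trans (closedSquare_subset_closedBall a s))
  refine ⟨{z | F z < δ ^ 3}, openSquare a s ∩ {z | δ ^ 3 < F z}, good_sublevel hFs hF hc hbd, hsub,
    (isOpen_openSquare a s).inter (isOpen_lt continuous_const hFs.continuous), ?_,
    inter_subset_left, ?_, ?_, ?_⟩
  · refine ⟨a + ⟨s - δ / 10, s - δ / 10⟩, ?_, ?_⟩
    · constructor <;> simp only [Complex.add_re, Complex.add_im, add_sub_cancel_left] <;>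
        rw [abs_of_nonneg] <;> linarith
    · show δ ^ 3 < F _
      simp only [hF_def, Complex.add_re, Complex.add_im, add_sub_cancel_left, wall_eq hb]
      rw [abs_of_nonneg (show 0 ≤ s - δ / 10 by linarith), max_eq_right (by linarith),
        show s - δ / 10 - b = 9 / 10 * δ by rw [hb_def]; ring]
      have : 0 < δ ^ 3 := by positivity
      nlinarith
  · rw [Set.disjoint_left]
    rintro z hz ⟨-, hz'⟩
    exact lt_asymm (show F z < δ ^ 3 from hz) hz'
  · intro z hz
    rw [frontier_sublevel hFs.continuous hF hc]
    rcases lt_trichotomy (F z) (δ ^ 3) with h | h | h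
    · exact Or.inl (Or.inl h)
    · exact Or.inr h
    · exact Or.inl (Or.inr ⟨hz, h⟩)
  · refine ⟨fun i => closedSquare (a + ⟨if i.1 then s else -s, if i.2 then s else -s⟩) δ, ?_, ?_⟩
    · rintro z ⟨hz, hFz⟩
      have hFz : δ ^ 3 < wall b (z.re - a.re) + wall b (z.im - a.im) := hFz
      have h1 := (wall_lt_iff hb hδ (z.re - a.re)).2 (by rw [hbs]; exact hz.1)
      have h2 := (wall_lt_iff hb hδ (z.im - a.im)).2 (by rw [hbs]; exact hz.2)
      have h3 := (wall_pos_iff hb (z.re - a.re)).1 (by linarith)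
      have h4 := (wall_pos_iff hb (z.im - a.im)).1 (by linarith)
      obtain ⟨i, hi⟩ := exists_sign h3.le hz.1.le
      obtain ⟨j, hj⟩ := exists_sign h4.le hz.2.le
      rw [hb_def, sub_sub_cancel] at hi hj
      refine mem_iUnion.2 ⟨(i, j), ?_, ?_⟩
      · simpa only [Complex.add_re, sub_sub] using hi
      · simpa only [Complex.add_im, sub_sub] using hj
    · intro i
      refine (Metric.ediam_mono (closedSquare_subset_closedBall _ _)).trans ?_
      refine Metric.ediam_le fun x hx y hy => ?_
      rw [edist_dist]
      refine ENNReal.ofReal_le_ofReal ((dist_triangle_right x y _).trans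
        ((add_le_add (Metric.mem_closedBall.1 hx) (Metric.mem_closedBall.1 hy)).trans ?_))
      linarith

/-- The centre of the dyadic square of level `q.1` and position `q.2`. -/
noncomputable def dyadicCenter (q : ℕ × ℤ × ℤ) : ℂ :=
  ⟨(q.2.1 + 1 / 2) / 2 ^ q.1, (q.2.2 + 1 / 2) / 2 ^ q.1⟩

/-- Half the side length of a dyadic square of level `q.1`. -/
noncomputable def dyadicRadius (q : ℕ × ℤ × ℤ) : ℝ := 1 / 2 / 2 ^ q.1

/-- The open dyadic square of level `q.1` and position `q.2`. -/
noncomputable def openDyadic (q : ℕ × ℤ × ℤ) : Set ℂ :=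
  openSquare (dyadicCenter q) (dyadicRadius q)

/-- The closed dyadic square of level `q.1` and position `q.2`. -/
noncomputable def closedDyadic (q : ℕ × ℤ × ℤ) : Set ℂ :=
  closedSquare (dyadicCenter q) (dyadicRadius q)

theorem dyadicRadius_pos (q : ℕ × ℤ × ℤ) : 0 < dyadicRadius q := by
  unfold dyadicRadius; positivity

theorem abs_sub_dyadic_lt_iff (n : ℕ) (i : ℤ) (x : ℝ) :
    |x - (i + 1 / 2) / 2 ^ n| < 1 / 2 / 2 ^ n ↔ i < 2 ^ n * x ∧ 2 ^ n * x < i + 1 := by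
  have h : (0 : ℝ) < 2 ^ n := by positivity
  have h2 : x - (i + 1 / 2) / 2 ^ n = (2 ^ n * x - (i + 1 / 2)) / 2 ^ n := by field_simp
  rw [h2, abs_div, abs_of_pos h, div_lt_div_iff_of_pos_right h, abs_lt]
  constructor
  · rintro ⟨h1, h2⟩; constructor <;> linarith
  · rintro ⟨h1, h2⟩; constructor <;> linarith

theorem mem_openDyadic_iff {n : ℕ} {i j : ℤ} {z : ℂ} : z ∈ openDyadic (n, i, j) ↔
    ((i : ℝ) < 2 ^ n * z.re ∧ 2 ^ n * z.re < i + 1) ∧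
      ((j : ℝ) < 2 ^ n * z.im ∧ 2 ^ n * z.im < j + 1) := by
  rw [← abs_sub_dyadic_lt_iff, ← abs_sub_dyadic_lt_iff]
  rfl

theorem dyadic_interval_nested {m k : ℕ} {i i' : ℤ} {x y : ℝ}
    (h1 : (i : ℝ) < 2 ^ (m + k) * x) (h2 : 2 ^ (m + k) * x < i + 1)
    (h3 : (i' : ℝ) < 2 ^ m * x) (h4 : 2 ^ m * x < i' + 1)
    (h5 : (i : ℝ) < 2 ^ (m + k) * y) (h6 : 2 ^ (m + k) * y < i + 1) :
    (i' : ℝ) < 2 ^ m * y ∧ 2 ^ m * y < i' + 1 := by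
  have hk : (0 : ℝ) < 2 ^ k := by positivity
  have e : ∀ x : ℝ, (2 : ℝ) ^ (m + k) * x = 2 ^ k * (2 ^ m * x) := fun x => by ring
  rw [e] at h1 h2 h5 h6
  have a1 : (2 : ℝ) ^ k * i' < i + 1 := (mul_lt_mul_of_pos_left h3 hk).trans h2
  have a2 : (i : ℝ) < 2 ^ k * (i' + 1) := h1.trans (mul_lt_mul_of_pos_left h4 hk)
  have b1 : (2 : ℤ) ^ k * i' < i + 1 := by exact_mod_cast a1
  have b2 : i < (2 : ℤ) ^ k * (i' + 1) := by exact_mod_cast a2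
  have c1 : (2 : ℤ) ^ k * i' ≤ i := by omega
  have c2 : i + 1 ≤ (2 : ℤ) ^ k * (i' + 1) := by omega
  have d1 : (2 : ℝ) ^ k * i' ≤ i := by exact_mod_cast c1
  have d2 : (i : ℝ) + 1 ≤ (2 : ℝ) ^ k * (i' + 1) := by exact_mod_cast c2
  exact ⟨lt_of_mul_lt_mul_left (d1.trans_lt h5) hk.le,
    lt_of_mul_lt_mul_left (h6.trans_le d2) hk.le⟩

theorem openDyadic_nested {p q : ℕ × ℤ × ℤ} (hpq : q.1 ≤ p.1)
    (h : (openDyadic p ∩ openDyadic q).Nonempty) : openDyadic p ⊆ openDyadic q := by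
  obtain ⟨n, i, j⟩ := p
  obtain ⟨m, i', j'⟩ := q
  obtain ⟨k, rfl⟩ := Nat.exists_eq_add_of_le hpq
  obtain ⟨z, hz, hz'⟩ := h
  intro w hw
  rw [mem_openDyadic_iff] at *
  exact ⟨dyadic_interval_nested hz.1.1 hz.1.2 hz'.1.1 hz'.1.2 hw.1.1 hw.1.2,
    dyadic_interval_nested hz.2.1 hz.2.2 hz'.2.1 hz'.2.2 hw.2.1 hw.2.2⟩

theorem eq_of_openDyadic_inter {p q : ℕ × ℤ × ℤ} (hpq : q.1 = p.1)
    (h : (openDyadic p ∩ openDyadic q).Nonempty) : p = q := by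
  obtain ⟨n, i, j⟩ := p
  obtain ⟨m, i', j'⟩ := q
  obtain rfl : m = n := hpq
  obtain ⟨z, hz, hz'⟩ := h
  rw [mem_openDyadic_iff] at *
  have key : ∀ {i i' : ℤ} {x : ℝ},
      (i : ℝ) < x → x < i + 1 → (i' : ℝ) < x → x < i' + 1 → i = i' := by
    intro i i' x h1 h2 h3 h4
    have a1 : (i : ℝ) < i' + 1 := h1.trans h4
    have a2 : (i' : ℝ) < i + 1 := h3.trans h2
    have b1 : i < i' + 1 := by exact_mod_cast a1
    have b2 : i' < i + 1 := by exact_mod_cast a2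
    omega
  rw [key hz.1.1 hz.1.2 hz'.1.1 hz'.1.2, key hz.2.1 hz.2.2 hz'.2.1 hz'.2.2]

theorem exists_openDyadic {z : ℂ} (h1 : Irrational z.re) (h2 : Irrational z.im) (n : ℕ) :
    ∃ q : ℕ × ℤ × ℤ, q.1 = n ∧ z ∈ openDyadic q := by
  have key : ∀ x : ℝ, Irrational x → ((⌊2 ^ n * x⌋ : ℤ) : ℝ) < 2 ^ n * x := by
    intro x hx
    refine lt_of_le_of_ne (Int.floor_le _) fun h => ?_
    have : Irrational ((2 ^ n : ℚ) * x) := hx.ratCast_mul (by positivity)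
    exact this ⟨⌊2 ^ n * x⌋, by push_cast; exact h⟩
  refine ⟨(n, ⌊2 ^ n * z.re⌋, ⌊2 ^ n * z.im⌋), rfl, ?_⟩
  rw [mem_openDyadic_iff]
  exact ⟨⟨key _ h1, Int.lt_floor_add_one _⟩, ⟨key _ h2, Int.lt_floor_add_one _⟩⟩

theorem exists_closedDyadic_subset {U : Set ℂ} (hU : IsOpen U) {z : ℂ} (hz : z ∈ U)
    (h1 : Irrational z.re) (h2 : Irrational z.im) :
    ∃ q : ℕ × ℤ × ℤ, z ∈ openDyadic q ∧ closedDyadic q ⊆ U := by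
  obtain ⟨ε, hε, hball⟩ := Metric.isOpen_iff.1 hU z hz
  obtain ⟨n, hn⟩ := exists_pow_lt_of_lt_one (half_pos hε) (show (1 / 2 : ℝ) < 1 by norm_num)
  obtain ⟨q, rfl, hq⟩ := exists_openDyadic h1 h2 n
  refine ⟨q, hq, fun w hw => hball ?_⟩
  rw [mem_ball_iff_norm]
  refine (Complex.norm_le_abs_re_add_abs_im _).trans_lt ?_
  have e : dyadicRadius q = 1 / 2 * (1 / 2) ^ q.1 := by
    rw [dyadicRadius, one_div_pow]; ring
  have key : ∀ {x y a s : ℝ}, |x - a| < s → |y - a| ≤ s → |y - x| < 2 * s := by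
    intro x y a s hx hy
    have := abs_sub_le y a x
    rw [abs_sub_comm a x] at this
    linarith
  have k1 := key hq.1 hw.1
  have k2 := key hq.2 hw.2
  rw [Complex.sub_re, Complex.sub_im]
  linarith

theorem exists_dyadic_decomposition {U : Set ℂ} (hU : IsOpen U) :
    ∃ M : Set (ℕ × ℤ × ℤ), (∀ q ∈ M, closedDyadic q ⊆ U) ∧ M.PairwiseDisjoint openDyadic ∧
      ∀ z ∈ U, Irrational z.re → Irrational z.im → ∃ q ∈ M, z ∈ openDyadic q := by
  refine ⟨{q | closedDyadic q ⊆ U ∧ ∀ p : ℕ × ℤ × ℤ, p.1 < q.1 →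
    (openDyadic q ∩ openDyadic p).Nonempty → ¬ closedDyadic p ⊆ U}, fun q hq => hq.1, ?_, ?_⟩
  · intro p hp q hq hne
    show Disjoint (openDyadic p) (openDyadic q)
    by_contra h
    rw [Set.not_disjoint_iff_nonempty_inter] at h
    rcases lt_trichotomy p.1 q.1 with h' | h' | h'
    · exact hq.2 p h' (by rwa [inter_comm]) hp.1
    · exact hne (eq_of_openDyadic_inter h'.symm h)
    · exact hp.2 q h' h hq.1
  · intro z hz h1 h2
    classical
    have hex : ∃ n : ℕ, ∃ q : ℕ × ℤ × ℤ, q.1 = n ∧ z ∈ openDyadic q ∧ closedDyadic q ⊆ U := by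
      obtain ⟨q, hq⟩ := exists_closedDyadic_subset hU hz h1 h2
      exact ⟨q.1, q, rfl, hq⟩
    obtain ⟨q, hqn, hzq, hqU⟩ := Nat.find_spec hex
    refine ⟨q, ⟨hqU, fun p hp hpq hpU => ?_⟩, hzq⟩
    rw [hqn] at hp
    exact Nat.find_min hex hp ⟨p, rfl, openDyadic_nested (hqn ▸ hp.le) hpq hzq, hpU⟩

theorem exists_irrational_coords {U : Set ℂ} (hU : IsOpen U) (hne : U.Nonempty) :
    ∃ z ∈ U, Irrational z.re ∧ Irrational z.im := by
  obtain ⟨z, hz⟩ := hne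
  obtain ⟨ε, hε, hball⟩ := Metric.isOpen_iff.1 hU z hz
  obtain ⟨x, hx, hx1, hx2⟩ := exists_irrational_btwn (show z.re < z.re + ε / 2 by linarith)
  obtain ⟨y, hy, hy1, hy2⟩ := exists_irrational_btwn (show z.im < z.im + ε / 2 by linarith)
  refine ⟨⟨x, y⟩, hball ?_, hx, hy⟩
  rw [mem_ball_iff_norm]
  refine (Complex.norm_le_abs_re_add_abs_im _).trans_lt ?_
  simp only [Complex.sub_re, Complex.sub_im]
  rw [abs_of_pos (by linarith), abs_of_pos (by linarith)]
  linarith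

/-- `S` is covered by countably many sets of finite one-dimensional Hausdorff measure. -/
def HasSigmaFiniteLength (S : Set ℂ) : Prop :=
  ∃ C : Set (Set ℂ), C.Countable ∧ S ⊆ ⋃₀ C ∧
    ∀ A ∈ C, (MeasureTheory.Measure.hausdorffMeasure 1 : MeasureTheory.Measure ℂ) A < ⊤

theorem HasSigmaFiniteLength.mono {S T : Set ℂ} (hT : HasSigmaFiniteLength T) (h : S ⊆ T) :
    HasSigmaFiniteLength S := by
  obtain ⟨C, h1, h2, h3⟩ := hT
  exact ⟨C, h1, h.trans h2, h3⟩

theorem HasSigmaFiniteLength.iUnion {ι : Type*} [Countable ι] {S : ι → Set ℂ}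
    (h : ∀ i, HasSigmaFiniteLength (S i)) : HasSigmaFiniteLength (⋃ i, S i) := by
  choose C h1 h2 h3 using h
  refine ⟨⋃ i, C i, countable_iUnion h1, ?_, ?_⟩
  · refine iUnion_subset fun i => (h2 i).trans (sUnion_subset_sUnion (subset_iUnion C i))
  · intro A hA
    obtain ⟨i, hi⟩ := mem_iUnion.1 hA
    exact h3 i A hi

theorem HasSigmaFiniteLength.of_lt_top {S : Set ℂ}
    (h : (MeasureTheory.Measure.hausdorffMeasure 1 : MeasureTheory.Measure ℂ) S < ⊤) :
    HasSigmaFiniteLength S :=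
  ⟨{S}, countable_singleton S, by simp, by simpa using h⟩

theorem HasSigmaFiniteLength.union {S T : Set ℂ} (hS : HasSigmaFiniteLength S)
    (hT : HasSigmaFiniteLength T) : HasSigmaFiniteLength (S ∪ T) := by
  rw [union_eq_iUnion]
  exact HasSigmaFiniteLength.iUnion fun b => by cases b <;> assumption

theorem hasSigmaFiniteLength_range {γ : ℝ → ℂ} (hγ : ContDiff ℝ 1 γ) :
    HasSigmaFiniteLength (range γ) := by
  have hcov : range γ ⊆ ⋃ n : ℕ, γ '' Icc (-(n : ℝ)) n := by
    rintro _ ⟨t, rfl⟩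
    obtain ⟨n, hn⟩ := exists_nat_ge |t|
    exact mem_iUnion.2 ⟨n, t, abs_le.1 hn, rfl⟩
  refine (HasSigmaFiniteLength.iUnion fun n => ?_).mono hcov
  apply HasSigmaFiniteLength.of_lt_top
  have hd : Continuous (deriv γ) := hγ.continuous_deriv le_rfl
  obtain ⟨K, hK⟩ := (isCompact_Icc (a := -(n : ℝ)) (b := n)).exists_bound_of_continuousOn
    hd.continuousOn
  have hL : LipschitzOnWith K.toNNReal γ (Icc (-(n : ℝ)) n) := by
    refine (convex_Icc _ _).lipschitzOnWith_of_nnnorm_deriv_le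
      (fun x _ => hγ.differentiable (by norm_num) x) fun x hx => ?_
    rw [← NNReal.coe_le_coe]
    exact (hK x hx).trans (Real.le_coe_toNNReal K)
  refine (hL.hausdorffMeasure_image_le zero_le_one).trans_lt ?_
  rw [MeasureTheory.hausdorffMeasure_real, Real.volume_Icc, ENNReal.rpow_one]
  exact ENNReal.mul_lt_top ENNReal.coe_lt_top ENNReal.ofReal_lt_top

theorem IsSmoothJordanCurve.hasSigmaFiniteLength {C : Set ℂ} (h : IsSmoothJordanCurve C) :
    HasSigmaFiniteLength C := by
  obtain ⟨γ, -, h2, -, -, rfl⟩ := h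
  exact hasSigmaFiniteLength_range (h2.of_le (by norm_num))

theorem hasSigmaFiniteLength_rational_grid :
    HasSigmaFiniteLength {z : ℂ | ¬ (Irrational z.re ∧ Irrational z.im)} := by
  have h1 : ∀ q : ℚ, HasSigmaFiniteLength (range fun t : ℝ => (q : ℂ) + t * Complex.I) := fun q =>
    hasSigmaFiniteLength_range (contDiff_const.add (Complex.ofRealCLM.contDiff.mul contDiff_const))
  have h2 : ∀ q : ℚ, HasSigmaFiniteLength (range fun t : ℝ => (t : ℂ) + q * Complex.I) := fun q =>
    hasSigmaFiniteLength_range (Complex.ofRealCLM.contDiff.add contDiff_const)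
  refine ((HasSigmaFiniteLength.iUnion h1).union (HasSigmaFiniteLength.iUnion h2)).mono ?_
  intro z hz
  rw [mem_ofPred_eq, not_and_or, Irrational, Irrational, not_not, not_not] at hz
  rcases hz with ⟨q, hq⟩ | ⟨q, hq⟩
  · refine Or.inl (mem_iUnion.2 ⟨q, z.im, ?_⟩)
    apply Complex.ext <;> simp [hq]
  · refine Or.inr (mem_iUnion.2 ⟨q, z.re, ?_⟩)
    apply Complex.ext <;> simp [hq]

theorem HasSigmaFiniteLength.exists_eq_iUnion {S : Set ℂ} (h : HasSigmaFiniteLength S) :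
    ∃ F : ℕ → Set ℂ, S = ⋃ n, F n ∧ ∀ n,
      (MeasureTheory.Measure.hausdorffMeasure 1 : MeasureTheory.Measure ℂ) (F n) < ⊤ := by
  obtain ⟨C, h1, h2, h3⟩ := h
  obtain ⟨f, hf⟩ := (h1.insert ∅).exists_eq_range (insert_nonempty _ _)
  refine ⟨fun n => S ∩ f n, ?_, fun n => ?_⟩
  · rw [← inter_iUnion, ← sUnion_range, ← hf, sUnion_insert, empty_union, inter_eq_left.2 h2]
  · refine (MeasureTheory.measure_mono inter_subset_right).trans_lt ?_
    have : f n ∈ insert ∅ C := hf ▸ mem_range_self n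
    rcases this with h | h
    · simp [h]
    · exact h3 _ h

theorem HasSigmaFiniteLength.dimH_le {S : Set ℂ} (h : HasSigmaFiniteLength S) : dimH S ≤ 1 := by
  obtain ⟨F, rfl, hF⟩ := h.exists_eq_iUnion
  rw [dimH_iUnion]
  exact iSup_le fun n => by
    have := dimH_le_of_hausdorffMeasure_ne_top (d := 1) (s := F n) (by simpa using (hF n).ne)
    simpa using this

theorem one_le_dimH_frontier {D : Set ℂ} (ho : IsOpen D) (hne : D.Nonempty)
    (hb : Bornology.IsBounded D) : 1 ≤ dimH (frontier D) := by
  have hsub : Complex.re '' D ⊆ Complex.re '' frontier D := by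
    rintro _ ⟨w, hw, rfl⟩
    set f : ℝ → ℂ := fun y => ⟨w.re, y⟩ with hf_def
    have hf : Continuous f := by
      have : f = fun y : ℝ => (w.re : ℂ) + y * Complex.I := by
        funext y
        apply Complex.ext <;> simp [hf_def]
      rw [this]; fun_prop
    have : (frontier (f ⁻¹' D)).Nonempty := by
      rw [nonempty_frontier_iff]
      refine ⟨⟨w.im, hw⟩, fun h => ?_⟩
      obtain ⟨R, hR0, hR⟩ := hb.exists_pos_norm_lt
      have h1 : R ∈ f ⁻¹' D := h ▸ mem_univ R
      have h2 := Complex.abs_im_le_norm (f R)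
      have h3 := hR _ h1
      simp only [hf_def, abs_of_pos hR0] at h2 h3
      linarith
    obtain ⟨y, hy⟩ := this
    exact ⟨f y, hf.frontier_preimage_subset D hy, rfl⟩
  have hop : IsOpen (Complex.re '' D) := Complex.isOpenMap_re D ho
  have h1 : dimH (Complex.re '' D) = 1 := by
    have := Real.dimH_of_nonempty_interior (s := Complex.re '' D)
      (by rw [hop.interior_eq]; exact hne.image _)
    simpa using this
  rw [← h1]
  refine (dimH_mono hsub).trans ?_
  have hL : LipschitzWith 1 Complex.re := by
    refine LipschitzWith.of_dist_le_mul fun x y => ?_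
    rw [NNReal.coe_one, one_mul, Complex.dist_eq, Real.dist_eq, ← Complex.sub_re]
    exact Complex.abs_re_le_norm _
  exact hL.dimH_image_le _

theorem exists_packing_step {U : Set ℂ} (hU : IsOpen U) (hne : U.Nonempty) {ε : ℝ≥0∞}
    (hε : ε ≠ 0) :
    ∃ (𝒟 : Set (Set ℂ)) (V : Set ℂ), 𝒟.Countable ∧ 𝒟.Nonempty ∧
      (∀ D ∈ 𝒟, IsGoodRegion D ∧ closure D ⊆ U ∧ Disjoint D V) ∧ 𝒟.PairwiseDisjoint id ∧
      IsOpen V ∧ V.Nonempty ∧ V ⊆ U ∧ HasSigmaFiniteLength (U \ (⋃₀ 𝒟 ∪ V)) ∧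
      ∃ t : (ℕ × ℤ × ℤ) × Bool × Bool → Set ℂ, V ⊆ ⋃ i, t i ∧
        ∑' i, Metric.ediam (t i) ≤ ε := by
  obtain ⟨M, hMU, hMd, hMc⟩ := exists_dyadic_decomposition hU
  obtain ⟨e, he, hsum⟩ := ENNReal.exists_pos_sum_of_countable hε (ℕ × ℤ × ℤ)
  have hδ : ∀ q, 0 < min (e q / 16 : ℝ) (dyadicRadius q / 2) := fun q =>
    lt_min (div_pos (NNReal.coe_pos.2 (he q)) (by norm_num)) (half_pos (dyadicRadius_pos q))
  have hδ' : ∀ q, min (e q / 16 : ℝ) (dyadicRadius q / 2) < dyadicRadius q := fun q =>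
    (min_le_right _ _).trans_lt (half_lt_self (dyadicRadius_pos q))
  choose D V hD hDQ hVo hVne hVQ hDV hcov t hVt ht using fun q =>
    exists_region_in_square (dyadicCenter q) (hδ q) (hδ' q)
  have hQU : ∀ q ∈ M, openDyadic q ⊆ U := fun q hq => (openSquare_subset _ _).trans (hMU q hq)
  obtain ⟨z₀, hz₀, hz₀r, hz₀i⟩ := exists_irrational_coords hU hne
  obtain ⟨q₀, hq₀, -⟩ := hMc z₀ hz₀ hz₀r hz₀i
  refine ⟨D '' M, ⋃ q ∈ M, V q, M.to_countable.image D, ⟨_, mem_image_of_mem D hq₀⟩, ?_, ?_,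
    isOpen_biUnion fun q _ => hVo q, ?_, ?_, ?_, fun i => {z | i.1 ∈ M ∧ z ∈ t i.1 i.2}, ?_, ?_⟩
  · rintro _ ⟨q, hq, rfl⟩
    refine ⟨hD q, ?_, ?_⟩
    · refine Subset.trans ?_ (hMU q hq)
      exact closure_minimal ((hDQ q).trans (openSquare_subset _ _)) (isClosed_closedSquare _ _)
    · rw [disjoint_iUnion₂_right]
      intro p hp
      by_cases hpq : q = p
      · exact hpq ▸ hDV q
      · exact (hMd hq hp hpq).mono (hDQ q) (hVQ p)
  · rintro _ ⟨q, hq, rfl⟩ _ ⟨p, hp, rfl⟩ hqp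
    exact (hMd hq hp fun h => hqp (h ▸ rfl)).mono (hDQ q) (hDQ p)
  · obtain ⟨z, hz⟩ := hVne q₀
    exact ⟨z, mem_biUnion hq₀ hz⟩
  · exact iUnion₂_subset fun q hq => (hVQ q).trans (hQU q hq)
  · refine (hasSigmaFiniteLength_rational_grid.union
      (HasSigmaFiniteLength.iUnion fun q => (hD q).2.1.hasSigmaFiniteLength)).mono ?_
    rintro z ⟨hzU, hz⟩
    by_cases hirr : Irrational z.re ∧ Irrational z.im
    · obtain ⟨q, hq, hzq⟩ := hMc z hzU hirr.1 hirr.2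
      refine Or.inr (mem_iUnion.2 ⟨q, ?_⟩)
      rcases hcov q hzq with (h | h) | h
      · exact absurd (Or.inl ⟨D q, mem_image_of_mem D hq, h⟩) hz
      · exact absurd (Or.inr (mem_biUnion hq h)) hz
      · exact h
    · exact Or.inl hirr
  · intro z hz
    obtain ⟨q, hq, hzq⟩ := mem_iUnion₂.1 hz
    obtain ⟨b, hb⟩ := mem_iUnion.1 (hVt q hzq)
    exact mem_iUnion.2 ⟨(q, b), hq, hb⟩
  · refine le_trans ?_ hsum.le
    rw [ENNReal.tsum_prod']
    refine ENNReal.tsum_le_tsum fun q => ?_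
    have hle : ∀ b : Bool × Bool,
        Metric.ediam {z | q ∈ M ∧ z ∈ t q b} ≤ ((e q / 4 : ℝ≥0) : ℝ≥0∞) := by
      intro b
      refine (Metric.ediam_mono fun z hz => hz.2).trans ((ht q b).trans ?_)
      rw [← ENNReal.ofReal_coe_nnreal]
      apply ENNReal.ofReal_le_ofReal
      have := min_le_left (e q / 16 : ℝ) (dyadicRadius q / 2)
      push_cast
      linarith
    rw [tsum_fintype]
    refine (Finset.sum_le_sum fun b _ => hle b).trans ?_
    rw [Finset.sum_const, nsmul_eq_mul, ← ENNReal.coe_natCast, ← ENNReal.coe_mul,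
      ENNReal.coe_le_coe]
    simp only [Finset.card_univ, Fintype.card_prod, Fintype.card_bool]
    rw [← NNReal.coe_le_coe]
    push_cast
    linarith

theorem hausdorffMeasure_one_eq_zero_of_covers {ι : Type*} [Countable ι] {S : Set ℂ}
    {ε : ℕ → ℝ≥0∞} (hε : Tendsto ε atTop (𝓝 0)) (t : ℕ → ι → Set ℂ) (hS : ∀ n, S ⊆ ⋃ i, t n i)
    (ht : ∀ n, ∑' i, Metric.ediam (t n i) ≤ ε n) :
    (MeasureTheory.Measure.hausdorffMeasure 1 : MeasureTheory.Measure ℂ) S = 0 := by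
  rw [← nonpos_iff_eq_zero]
  refine (MeasureTheory.Measure.hausdorffMeasure_le_liminf_tsum 1 S ε hε t
    (Eventually.of_forall fun n i => (ENNReal.le_tsum i).trans (ht n))
    (Eventually.of_forall hS)).trans ?_
  rw [← hε.liminf_eq]
  exact liminf_le_liminf (Eventually.of_forall fun n => by simpa using ht n)

theorem exists_packing {Ω : Set ℂ} (hΩ : IsOpen Ω) (hne : Ω.Nonempty) :
    ∃ 𝒜 : Set (Set ℂ), 𝒜.Countable ∧ 𝒜.Infinite ∧ (∀ D ∈ 𝒜, IsGoodRegion D ∧ closure D ⊆ Ω) ∧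
      𝒜.PairwiseDisjoint id ∧ HasSigmaFiniteLength (Ω \ ⋃₀ 𝒜) := by
  have hε : ∀ n : ℕ, ((n : ℝ≥0∞))⁻¹ ≠ 0 := fun n => by simp
  choose 𝒟 V hcount hDne hD hdisj hVo hVne hVU hσ t hVt ht using
    fun (n : ℕ) (W : {W : Set ℂ // IsOpen W ∧ W.Nonempty}) =>
      exists_packing_step W.2.1 W.2.2 (hε n)
  let U : ℕ → {W : Set ℂ // IsOpen W ∧ W.Nonempty} := fun n =>
    Nat.rec ⟨Ω, hΩ, hne⟩ (fun n W => ⟨V n W, hVo n W, hVne n W⟩) n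
  have hanti : Antitone (fun n : ℕ => (U n).1) :=
    antitone_nat_of_succ_le fun n => hVU n (U n)
  have hsubU : ∀ n, ∀ D ∈ 𝒟 n (U n), D ⊆ (U n).1 := fun n D h =>
    subset_closure.trans (hD n _ D h).2.1
  have hcross : ∀ m n, m < n → ∀ D ∈ 𝒟 m (U m), ∀ E ∈ 𝒟 n (U n), Disjoint D E := by
    intro m n hmn D hDm E hEn
    exact (hD m _ D hDm).2.2.mono_right ((hsubU n E hEn).trans (hanti (Nat.succ_le_of_lt hmn)))
  refine ⟨⋃ n, 𝒟 n (U n), countable_iUnion fun n => hcount n _, ?_, ?_, ?_, ?_⟩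
  · choose E hE using fun n => hDne n (U n)
    refine Set.infinite_of_injective_forall_mem (f := E) ?_ fun n => mem_iUnion.2 ⟨n, hE n⟩
    have hEne : ∀ n, (E n).Nonempty := fun n => (hD n _ _ (hE n)).1.1.2.1.nonempty
    intro m n hmn
    rcases lt_trichotomy m n with h | h | h
    · have := hcross m n h _ (hE m) _ (hE n)
      rw [hmn, disjoint_self] at this
      exact absurd this (hEne n).ne_empty
    · exact h
    · have := hcross n m h _ (hE n) _ (hE m)
      rw [hmn, disjoint_self] at this
      exact absurd this (hEne n).ne_empty
  · intro D h
    obtain ⟨n, hn⟩ := mem_iUnion.1 h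
    exact ⟨(hD n _ D hn).1, (hD n _ D hn).2.1.trans (hanti (Nat.zero_le n))⟩
  · intro D h E h' hDE
    obtain ⟨m, hm⟩ := mem_iUnion.1 h
    obtain ⟨n, hn⟩ := mem_iUnion.1 h'
    rcases lt_trichotomy m n with h | h | h
    · exact hcross m n h D hm E hn
    · subst h
      exact hdisj m _ hm hn hDE
    · exact (hcross n m h E hn D hm).symm
  · have hzero : HasSigmaFiniteLength (⋂ n, (U n).1) := by
      apply HasSigmaFiniteLength.of_lt_top
      rw [hausdorffMeasure_one_eq_zero_of_covers ENNReal.tendsto_inv_nat_nhds_zero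
        (fun n => t n (U n)) (fun n => (iInter_subset _ (n + 1)).trans (hVt n (U n)))
        fun n => ht n (U n)]
      exact ENNReal.zero_lt_top
    refine ((HasSigmaFiniteLength.iUnion fun n => hσ n (U n)).union hzero).mono ?_
    rintro z ⟨hzΩ, hz⟩
    by_cases hall : ∀ n, z ∈ (U n).1
    · exact Or.inr (mem_iInter.2 hall)
    · left
      classical
      rw [not_forall] at hall
      have hspec := Nat.find_spec hall
      obtain ⟨m, hm⟩ := Nat.exists_eq_succ_of_ne_zero (n := Nat.find hall) fun h => by
        rw [h] at hspec
        exact hspec hzΩ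
      rw [hm] at hspec
      have hmU : z ∈ (U m).1 := not_not.1 (Nat.find_min hall (by omega))
      refine mem_iUnion.2 ⟨m, hmU, ?_⟩
      rintro (⟨D, hDm, hzD⟩ | h)
      · exact hz ⟨D, mem_iUnion.2 ⟨m, hDm⟩, hzD⟩
      · exact hspec h

theorem stmt19 (Ω : Set ℂ) (hΩ : IsOpen Ω) (hne : Ω.Nonempty) :
    ∃ D : ℕ → Set ℂ,
      (∀ i, IsJordanRegion (D i) ∧ D i ⊆ Ω ∧
        IsSmoothJordanCurve (frontier (D i)) ∧ Convex ℝ (closure (D i))) ∧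
      Pairwise (Function.onFun Disjoint D) ∧
      (∃ F : ℕ → Set ℂ, (Ω \ ⋃ i, D i) = ⋃ n, F n ∧ ∀ n,
        (MeasureTheory.Measure.hausdorffMeasure 1 : MeasureTheory.Measure ℂ) (F n) < ⊤) ∧
      dimH (Ω \ ⋃ i, D i) = 1 := by
  obtain ⟨𝒜, hcount, hinf, hgood, hdisj, hσ⟩ := exists_packing hΩ hne
  have := hcount.to_subtype
  have := hinf.to_subtype
  obtain ⟨hden⟩ := nonempty_denumerable 𝒜
  set φ : ℕ ≃ 𝒜 := (Denumerable.eqv 𝒜).symm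
  have hU : ⋃₀ 𝒜 = ⋃ i, (φ i : Set ℂ) := by
    rw [sUnion_eq_iUnion, φ.surjective.iUnion_comp (fun A : 𝒜 => (A : Set ℂ))]
  rw [hU] at hσ
  have hpair : Pairwise (Function.onFun Disjoint fun i => (φ i : Set ℂ)) := fun i j hij =>
    hdisj (φ i).2 (φ j).2 fun h => hij (φ.injective (Subtype.ext h))
  refine ⟨fun i => φ i, fun i => ?_, hpair, hσ.exists_eq_iUnion, hσ.dimH_le.antisymm ?_⟩
  · obtain ⟨h, hcl⟩ := hgood _ (φ i).2
    exact ⟨h.1, subset_closure.trans hcl, h.2⟩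
  · obtain ⟨⟨⟨ho, hconn, hb, -⟩, -⟩, hcl⟩ := hgood _ (φ 0).2
    refine (one_le_dimH_frontier ho hconn.nonempty hb).trans (dimH_mono ?_)
    refine subset_sdiff.2 ⟨frontier_subset_closure.trans hcl, ?_⟩
    rw [disjoint_iUnion_right]
    intro i
    by_cases hi : i = 0
    · rw [hi]
      exact disjoint_frontier_iff_isOpen.2 ho
    · have hoi : IsOpen (φ i : Set ℂ) := (hgood _ (φ i).2).1.1.1
      exact ((hpair (Ne.symm hi)).closure_left hoi).mono_left frontier_subset_closure
end
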